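/- arXiv:2605.18737 — 2 statements merged into one kernel-verified Lean document; each statement's English description precedes it below -/
import Mathlib

section
/- Let 𝒱 = (V, {a₀, a₁}) be a primitive 2-generated M(α,β)-axial algebra over F. (1) If a₁ − a₋₁ = x(a₂ − a₋₂) for some x ∈ F∖{0}, then ((1−α)(λ₁^f − λ₁) + (β/2)(α−β)(1/x − x))·(a₁ − a₋₁) − (β/2)(α−β)·x·(a₃ − a₋₃) = 0. (2) If a₀ − a₂ = x(a₋₁ − a₃) for some x ∈ F∖{0}, then ((1−α)(λ₁ − λ₁^f) + (β/2)(α−β)(1/x − x))·(a₀ − a₂) − (β/2)(α−β)·x·(a₋₂ − a₄) = 0. -/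
namespace AxialFormal

universe u v

variable (F : Type u) [Field F] {V : Type v} [NonUnitalNonAssocCommRing V]
  [Module F V] [SMulCommClass F V V] [IsScalarTower F V V]

/-- The `μ`-eigenspace of the adjoint map `ad_a : x ↦ a * x`. -/
def eigSp (a : V) (μ : F) : Submodule F V where
  carrier := {w | a * w = μ • w}
  add_mem' := by
    intro x y hx hy
    simp only [Set.mem_setOf_eq] at hx hy ⊢
    rw [mul_add, hx, hy, smul_add]
  zero_mem' := by
    simp only [Set.mem_setOf_eq, mul_zero, smul_zero]
  smul_mem' := by
    intro c x hx
    simp only [Set.mem_setOf_eq] at hx ⊢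
    rw [mul_smul_comm, hx, smul_comm]

/-- `a` is a primitive axis of Monster type `(α, β)` in the commutative
(not necessarily associative or unital) `F`-algebra `V`. -/
structure IsAxis (α β : F) (a : V) : Prop where
  idem : a * a = a
  primitive : eigSp F a 1 = Submodule.span F {a}
  decomp : eigSp F a 1 ⊔ eigSp F a 0 ⊔ eigSp F a α ⊔ eigSp F a β = ⊤
  fusion_one_zero : ∀ u ∈ eigSp F a 1, ∀ w ∈ eigSp F a 0, u * w = 0
  fusion_one_alpha : ∀ u ∈ eigSp F a 1, ∀ w ∈ eigSp F a α, u * w ∈ eigSp F a α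
  fusion_one_beta : ∀ u ∈ eigSp F a 1, ∀ w ∈ eigSp F a β, u * w ∈ eigSp F a β
  fusion_zero_zero : ∀ u ∈ eigSp F a 0, ∀ w ∈ eigSp F a 0, u * w ∈ eigSp F a 0
  fusion_zero_alpha : ∀ u ∈ eigSp F a 0, ∀ w ∈ eigSp F a α, u * w ∈ eigSp F a α
  fusion_zero_beta : ∀ u ∈ eigSp F a 0, ∀ w ∈ eigSp F a β, u * w ∈ eigSp F a β
  fusion_alpha_alpha : ∀ u ∈ eigSp F a α, ∀ w ∈ eigSp F a α,
    u * w ∈ eigSp F a 1 ⊔ eigSp F a 0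
  fusion_alpha_beta : ∀ u ∈ eigSp F a α, ∀ w ∈ eigSp F a β, u * w ∈ eigSp F a β
  fusion_beta_beta : ∀ u ∈ eigSp F a β, ∀ w ∈ eigSp F a β,
    u * w ∈ eigSp F a 1 ⊔ eigSp F a 0 ⊔ eigSp F a α

/-- `(V, {a₀, a₁})` is a primitive 2-generated axial algebra of Monster type `(α, β)`. -/
structure IsTwoGenerated (α β : F) (a₀ a₁ : V) : Prop where
  axis₀ : IsAxis F α β a₀
  axis₁ : IsAxis F α β a₁
  generates : NonUnitalAlgebra.adjoin F {a₀, a₁} = ⊤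

/-- `τ` is the Miyamoto involution associated to the axis `a` : it is an algebra
automorphism fixing `V₁ᵃ + V₀ᵃ + Vαᵃ` pointwise and negating `Vβᵃ`. -/
structure IsMiyamoto (α β : F) (a : V) (τ : V ≃ₗ[F] V) : Prop where
  map_mul : ∀ x y : V, τ (x * y) = τ x * τ y
  fix_plus : ∀ w ∈ eigSp F a 1 ⊔ eigSp F a 0 ⊔ eigSp F a α, τ w = w
  neg_beta : ∀ w ∈ eigSp F a β, τ w = -w

/-- The bi-infinite sequence of axes `a_j`, with `a_{2i} = a₀^{ρ^i}` and
`a_{2i+1} = a₁^{ρ^i}` where `ρ = τ₀τ₁` (as a right action, `v^ρ = τ₁ (τ₀ v)`). -/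
def axSeq (a₀ a₁ : V) (τ₀ τ₁ : V ≃ₗ[F] V) (j : ℤ) : V :=
  if j % 2 = 0 then ((τ₁ * τ₀) ^ (j / 2)) a₀ else ((τ₁ * τ₀) ^ ((j - 1) / 2)) a₁

/-- The orbit of `b` under the Miyamoto group `⟨τ₀, τ₁⟩`. -/
def miyOrbit (τ₀ τ₁ : V ≃ₗ[F] V) (b : V) : Set V :=
  {w | ∃ g ∈ Subgroup.closure ({τ₀, τ₁} : Set (V ≃ₗ[F] V)), g b = w}

/-- The axet of `(V,{a₀,a₁})` is regular: the two orbits have the same cardinality. -/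
def HasRegularAxet (a₀ a₁ : V) (τ₀ τ₁ : V ≃ₗ[F] V) : Prop :=
  Nonempty ((miyOrbit F τ₀ τ₁ a₀) ≃ (miyOrbit F τ₀ τ₁ a₁))

/-- `l` is the projection `λ_a(x)` of `x` onto the primitive axis `a`:
`x = l • a + x₀ + x_α + x_β` with `x_μ ∈ V_μ^a`. -/
def HasProj (α β : F) (a x : V) (l : F) : Prop :=
  ∃ v₀ ∈ eigSp F a 0, ∃ vα ∈ eigSp F a α, ∃ vβ ∈ eigSp F a β,
    x = l • a + v₀ + vα + vβ


theorem miy_key {α β : F} {a b s : V} {τ : V ≃ₗ[F] V} {l : F} (h2 : (2 : F) ≠ 0)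
    (hA : IsAxis F α β a) (hτ : IsMiyamoto F α β a τ) (hp : HasProj F α β a b l)
    (hs : s = a * b - β • (a + b)) :
    τ s = s ∧ a * s = (α - β) • s + ((α - 1) * (β - l) - β ^ 2) • a
      + (β / 2 * (α - β)) • (b + τ b) := by
  obtain ⟨v0, h0, va, ha, vb, hb, rfl⟩ := hp
  have ta : τ a = a := hτ.fix_plus a (Submodule.mem_sup_left (Submodule.mem_sup_left (by
    rw [hA.primitive]; exact Submodule.mem_span_singleton_self a)))
  have t0 : τ v0 = v0 := hτ.fix_plus v0 (Submodule.mem_sup_left (Submodule.mem_sup_right h0))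
  have tα : τ va = va := hτ.fix_plus va (Submodule.mem_sup_right ha)
  have tβ : τ vb = -vb := hτ.neg_beta vb hb
  have m0 : a * v0 = (0 : F) • v0 := h0
  have mα : a * va = α • va := ha
  have mβ : a * vb = β • vb := hb
  have es : s = (l - β - β * l) • a - β • v0 + (α - β) • va := by
    rw [hs]
    simp only [mul_add, mul_smul_comm, hA.idem, m0, mα, mβ]
    module
  clear hs
  subst es
  constructor
  · simp only [map_add, map_sub, map_smul, ta, t0, tα]
  · have e3 : a * ((l - β - β * l) • a - β • v0 + (α - β) • va)
        = (l - β - β * l) • a + (α - β) • α • va := by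
      rw [mul_add, mul_sub, mul_smul_comm, mul_smul_comm, mul_smul_comm, hA.idem, m0, mα]
      module
    rw [e3]
    simp only [map_add, map_smul, ta, t0, tα, tβ]
    have e : (l • a + v0 + va + vb + (l • a + v0 + va + -vb)) = (2 : F) • (l • a + v0 + va) := by
      module
    have e2 : β / 2 * (α - β) * 2 = β * (α - β) := by field_simp
    rw [e, smul_smul (β / 2 * (α - β)) 2, e2]
    module

theorem miy_invol {α β : F} {a : V} {τ : V ≃ₗ[F] V}
    (hA : IsAxis F α β a) (hτ : IsMiyamoto F α β a τ) (v : V) : τ (τ v) = v := by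
  have hv : v ∈ eigSp F a 1 ⊔ eigSp F a 0 ⊔ eigSp F a α ⊔ eigSp F a β := by
    rw [hA.decomp]; trivial
  obtain ⟨y, hy, z, hz, rfl⟩ := Submodule.mem_sup.1 hv
  simp [hτ.fix_plus y hy, hτ.neg_beta z hz]

theorem miy_half {α β : F} {a b : V} {τ σ : V ≃ₗ[F] V} {l m : F} (h2 : (2 : F) ≠ 0)
    (hA : IsAxis F α β a) (hB : IsAxis F α β b)
    (hτ : IsMiyamoto F α β a τ) (hσ : IsMiyamoto F α β b σ)
    (hp : HasProj F α β a b l) (hq : HasProj F α β b a m)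
    (x : F) (hx : x ≠ 0) (h : b - τ b = x • (σ a - τ (σ a))) :
    ((1 - α) * (m - l) + β / 2 * (α - β) * (x⁻¹ - x)) • (b - τ b)
        - (β / 2 * (α - β) * x) • (σ (τ b) - τ (σ (τ b))) = 0 := by
  have fa : τ a = a := hτ.fix_plus a (Submodule.mem_sup_left (Submodule.mem_sup_left (by
    rw [hA.primitive]; exact Submodule.mem_span_singleton_self a)))
  have fb : σ b = b := hσ.fix_plus b (Submodule.mem_sup_left (Submodule.mem_sup_left (by
    rw [hB.primitive]; exact Submodule.mem_span_singleton_self b)))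
  obtain ⟨s, hs⟩ : ∃ s, s = a * b - β • (a + b) := ⟨_, rfl⟩
  obtain ⟨ts, as⟩ := miy_key F h2 hA hτ hp hs
  obtain ⟨us, bs⟩ := miy_key F h2 hB hσ hq (s := s) (by rw [hs, mul_comm, add_comm])
  generalize β / 2 * (α - β) = c at *
  have e1 := congrArg τ bs
  have e2 := congrArg σ as
  have e3 := congrArg τ (congrArg σ as)
  simp only [hτ.map_mul, hσ.map_mul, map_add, map_smul, ts, us, fa, fb] at e1 e2 e3
  have e4 := congrArg (· * s) h
  simp only [sub_mul, smul_mul_assoc, bs, e1, e2, e3] at e4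
  have h' : σ a - τ (σ a) = x⁻¹ • (b - τ b) := by rw [h, smul_smul, inv_mul_cancel₀ hx, one_smul]
  linear_combination (norm := module) e4 - c • h' - ((α - 1) * (β - l) - β ^ 2) • h

/-- Relations forced by a linear dependence among differences of axes. -/
theorem cor_a1xa2 {α β : F}
    (hchar : (2 : F) ≠ 0)
    (hα0 : α ≠ 0) (hα1 : α ≠ 1) (hβ0 : β ≠ 0) (hβ1 : β ≠ 1) (hαβ : α ≠ β)
    {a₀ a₁ : V} (hV : IsTwoGenerated F α β a₀ a₁)
    (τ₀ τ₁ : V ≃ₗ[F] V) (hτ₀ : IsMiyamoto F α β a₀ τ₀) (hτ₁ : IsMiyamoto F α β a₁ τ₁)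
    (a : ℤ → V) (ha : a = axSeq F a₀ a₁ τ₀ τ₁)
    (l1 l1f : F)
    (hl1 : HasProj F α β a₀ a₁ l1) (hl1f : HasProj F α β a₁ a₀ l1f) :
    (∀ x : F, x ≠ 0 → a 1 - a (-1) = x • (a 2 - a (-2)) →
      ((1 - α) * (l1f - l1) + β / 2 * (α - β) * (x⁻¹ - x)) • (a 1 - a (-1))
        - (β / 2 * (α - β) * x) • (a 3 - a (-3)) = 0) ∧
    (∀ x : F, x ≠ 0 → a 0 - a 2 = x • (a (-1) - a 3) →
      ((1 - α) * (l1 - l1f) + β / 2 * (α - β) * (x⁻¹ - x)) • (a 0 - a 2)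
        - (β / 2 * (α - β) * x) • (a (-2) - a 4) = 0) := by
  have i0 := miy_invol F hV.axis₀ hτ₀
  have i1 := miy_invol F hV.axis₁ hτ₁
  have f0 : τ₀ a₀ = a₀ := hτ₀.fix_plus a₀ (Submodule.mem_sup_left (Submodule.mem_sup_left (by
    rw [hV.axis₀.primitive]; exact Submodule.mem_span_singleton_self a₀)))
  have f1 : τ₁ a₁ = a₁ := hτ₁.fix_plus a₁ (Submodule.mem_sup_left (Submodule.mem_sup_left (by
    rw [hV.axis₁.primitive]; exact Submodule.mem_span_singleton_self a₁)))
  have j0 : τ₀⁻¹ = τ₀ := inv_eq_of_mul_eq_one_left (LinearEquiv.ext i0)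
  have j1 : τ₁⁻¹ = τ₁ := inv_eq_of_mul_eq_one_left (LinearEquiv.ext i1)
  have p : ∀ v, ((τ₁ * τ₀) ^ (1 : ℤ)) v = τ₁ (τ₀ v) := fun v => by rw [zpow_one]; rfl
  have q : ∀ v, ((τ₁ * τ₀) ^ (2 : ℤ)) v = τ₁ (τ₀ (τ₁ (τ₀ v))) := fun v => by
    rw [zpow_two]; rfl
  have p' : ∀ v, ((τ₁ * τ₀) ^ (-1 : ℤ)) v = τ₀ (τ₁ v) := fun v => by
    rw [zpow_neg_one, mul_inv_rev, j0, j1]; rfl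
  have q' : ∀ v, ((τ₁ * τ₀) ^ (-2 : ℤ)) v = τ₀ (τ₁ (τ₀ (τ₁ v))) := fun v => by
    rw [zpow_neg, zpow_two, mul_inv_rev, mul_inv_rev, j0, j1]; rfl
  have A0 : a 0 = a₀ := by rw [ha]; simp [axSeq]
  have A1 : a 1 = a₁ := by rw [ha]; simp [axSeq]
  have A2 : a 2 = τ₁ a₀ := by rw [ha]; norm_num [axSeq]; rw [f0]
  have A3 : a 3 = τ₁ (τ₀ a₁) := by rw [ha]; norm_num [axSeq]
  have A4 : a 4 = τ₁ (τ₀ (τ₁ a₀)) := by rw [ha]; change ((τ₁ * τ₀) ^ (2 : ℤ)) a₀ = _; rw [q, f0]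
  have B1 : a (-1) = τ₀ a₁ := by
    rw [ha]; change ((τ₁ * τ₀) ^ (-1 : ℤ)) a₁ = _; rw [p', f1]
  have B2 : a (-2) = τ₀ (τ₁ a₀) := by
    rw [ha]; change ((τ₁ * τ₀) ^ (-1 : ℤ)) a₀ = _; rw [p']
  have B3 : a (-3) = τ₀ (τ₁ (τ₀ a₁)) := by
    rw [ha]; change ((τ₁ * τ₀) ^ (-2 : ℤ)) a₁ = _; rw [q', f1]
  rw [A0, A1, A2, A3, A4, B1, B2, B3]
  exact ⟨fun x hx h => miy_half F hchar hV.axis₀ hV.axis₁ hτ₀ hτ₁ hl1 hl1f x hx h,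
    fun x hx h => miy_half F hchar hV.axis₁ hV.axis₀ hτ₁ hτ₀ hl1f hl1 x hx h⟩

end AxialFormal
end

section
/- Let 𝒱 = (V, {a₀, a₁}) be a primitive 2-generated M(α,β)-axial algebra over F. Assume λ₁ = λ₁^f and λ₂ = λ₂^f, and suppose further that either (α,β) ≠ (2,1/2), or λ₃ = λ₃^f and V is spanned as an F-vector space by the set {a₋₂, a₋₁, a₀, a₁, a₂, a₃, s_{0,1}, s_{0,2}}. Then 𝒱 is isomorphic to a quotient of a symmetric algebra. -/
namespace AxialFormal

universe u v

variable (F : Type u) [Field F] {V : Type v} [NonUnitalNonAssocCommRing V]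
  [Module F V] [SMulCommClass F V V] [IsScalarTower F V V]

/-- The 2-generated axial algebra `(V, {a₀, a₁})` is symmetric: it admits a flip,
i.e. an algebra automorphism interchanging `a₀` and `a₁`. -/
def IsSymmetric (a₀ a₁ : V) : Prop :=
  ∃ f : V ≃ₗ[F] V, (∀ x y : V, f (x * y) = f x * f y) ∧ f a₀ = a₁ ∧ f a₁ = a₀

/-- A bundled commutative (not necessarily associative or unital) `F`-algebra. -/
structure AlgModel where
  carrier : Type (max u v)
  [isRing : NonUnitalNonAssocCommRing carrier]
  [isModule : Module F carrier]
  [isSMulComm : SMulCommClass F carrier carrier]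
  [isTower : IsScalarTower F carrier carrier]

attribute [instance] AlgModel.isRing AlgModel.isModule AlgModel.isSMulComm
  AlgModel.isTower

/-- `(V,{a₀,a₁})` is isomorphic to a quotient of a symmetric primitive 2-generated
`M(α,β)`-axial algebra: there are such an algebra `(W,{b₀,b₁})` and a surjective
multiplication-preserving linear map `W → V` sending `{b₀,b₁}` to `{a₀,a₁}`. -/
def IsQuotientOfSymmetric (α β : F) (a₀ a₁ : V) : Prop :=
  ∃ M : AlgModel.{u, v} F, ∃ b₀ b₁ : M.carrier,
    IsTwoGenerated F α β b₀ b₁ ∧ IsSymmetric F b₀ b₁ ∧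
    ∃ θ : M.carrier →ₗ[F] V, Function.Surjective θ ∧
      (∀ x y : M.carrier, θ (x * y) = θ x * θ y) ∧
      ({θ b₀, θ b₁} : Set V) = {a₀, a₁}


section
variable {F}
set_option linter.unusedSectionVars false
set_option linter.unusedSimpArgs false
set_option linter.unusedVariables false


theorem mem_eig {a w : V} {μ : F} : w ∈ eigSp F a μ ↔ a * w = μ • w := Iff.rfl

/-- complement of the 1-eigenspace -/
def Kc (α β : F) (a : V) : Submodule F V := eigSp F a 0 ⊔ eigSp F a α ⊔ eigSp F a β

theorem hasProj_iff {α β : F} {a x : V} {l : F} :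
    HasProj F α β a x l ↔ x - l • a ∈ Kc α β a := by
  unfold HasProj Kc
  constructor
  · rintro ⟨v0, h0, v1, h1, v2, h2, rfl⟩
    have : l • a + v0 + v1 + v2 - l • a = v0 + v1 + v2 := by module
    rw [this]
    exact Submodule.add_mem_sup (Submodule.add_mem_sup h0 h1) h2
  · intro h
    obtain ⟨y, hy, v2, h2, e⟩ := Submodule.mem_sup.1 h
    obtain ⟨v0, h0, v1, h1, e'⟩ := Submodule.mem_sup.1 hy
    refine ⟨v0, h0, v1, h1, v2, h2, ?_⟩
    linear_combination (norm := module) -e - e'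

theorem HasProj.add {α β : F} {a x y : V} {l m : F} (hx : HasProj F α β a x l)
    (hy : HasProj F α β a y m) : HasProj F α β a (x + y) (l + m) := by
  rw [hasProj_iff] at *
  have := Submodule.add_mem _ hx hy
  convert this using 1; module

theorem HasProj.smul {α β : F} {a x : V} {l : F} (c : F) (hx : HasProj F α β a x l) :
    HasProj F α β a (c • x) (c * l) := by
  rw [hasProj_iff] at *
  have := Submodule.smul_mem _ c hx
  convert this using 1; module

theorem HasProj.sub {α β : F} {a x y : V} {l m : F} (hx : HasProj F α β a x l)
    (hy : HasProj F α β a y m) : HasProj F α β a (x - y) (l - m) := by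
  rw [hasProj_iff] at *
  have := Submodule.sub_mem _ hx hy
  convert this using 1; module

theorem HasProj.self {α β : F} {a : V} : HasProj F α β a a 1 := by
  rw [hasProj_iff]; simp

theorem HasProj.ezero {α β : F} {a x : V} (h : x ∈ eigSp F a 0) : HasProj F α β a x 0 := by
  rw [hasProj_iff]; unfold Kc; simpa using Submodule.mem_sup_left (Submodule.mem_sup_left h)

theorem HasProj.ealpha {α β : F} {a x : V} (h : x ∈ eigSp F a α) : HasProj F α β a x 0 := by
  rw [hasProj_iff]; unfold Kc; simpa using Submodule.mem_sup_left (Submodule.mem_sup_right h)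

theorem HasProj.ebeta {α β : F} {a x : V} (h : x ∈ eigSp F a β) : HasProj F α β a x 0 := by
  rw [hasProj_iff]; unfold Kc; simpa using Submodule.mem_sup_right h

theorem HasProj.congr {α β : F} {a x y : V} {l m : F} (hx : HasProj F α β a x l)
    (e : x = y) (e' : l = m) : HasProj F α β a y m := by subst e; subst e'; exact hx

/-- parameters -/
structure Par (α β : F) : Prop where
  two : (2 : F) ≠ 0
  a0 : α ≠ 0
  a1 : α ≠ 1
  b0 : β ≠ 0
  b1 : β ≠ 1
  ab : α ≠ β

theorem eig_indep {α β : F} (P : Par α β) {a x y z w : V} (hx : x ∈ eigSp F a 1)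
    (hy : y ∈ eigSp F a 0) (hz : z ∈ eigSp F a α) (hw : w ∈ eigSp F a β)
    (h : x + y + z + w = 0) : x = 0 := by
  rw [mem_eig] at *
  have h1 : x + α • z + β • w = 0 := by
    have := congrArg (a * ·) h
    simp only [mul_add, hx, hy, hz, hw, mul_zero] at this
    linear_combination (norm := module) this
  have h2 : x + α • α • z + β • β • w = 0 := by
    have := congrArg (a * ·) h1
    simp only [mul_add, hx, hy, hz, hw, mul_zero, mul_smul_comm] at this
    linear_combination (norm := module) this
  have h3 : x + α • α • α • z + β • β • β • w = 0 := by
    have := congrArg (a * ·) h2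
    simp only [mul_add, hx, hy, hz, hw, mul_zero, mul_smul_comm] at this
    linear_combination (norm := module) this
  have h4 : ((1 - α) * (1 - β)) • x = 0 := by
    linear_combination (norm := module) h3 - (α + β) • h2 + (α * β) • h1
  have : (1 - α) * (1 - β) ≠ 0 := mul_ne_zero (sub_ne_zero.2 P.a1.symm) (sub_ne_zero.2 P.b1.symm)
  exact (smul_eq_zero.1 h4).resolve_left this

theorem HasProj.one_eq {α β : F} (P : Par α β) {a x : V} {l : F} (h : HasProj F α β a x l)
    (hx : x ∈ eigSp F a 1) (ha : a * a = a) : x = l • a := by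
  obtain ⟨v0, h0, v1, h1, v2, h2, e⟩ := h
  have ha' : a ∈ eigSp F a 1 := by rw [mem_eig, ha, one_smul]
  have := eig_indep P (x := l • a - x) (Submodule.sub_mem _ (Submodule.smul_mem _ _ ha') hx) h0 h1 h2
    (by linear_combination (norm := module) -e)
  linear_combination (norm := module) -this


/-- the part of the axis axioms used in computations -/
structure PAx (α β : F) (a : V) : Prop where
  idem : a * a = a
  f00 : ∀ u ∈ eigSp F a 0, ∀ w ∈ eigSp F a 0, u * w ∈ eigSp F a 0
  f0a : ∀ u ∈ eigSp F a 0, ∀ w ∈ eigSp F a α, u * w ∈ eigSp F a α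
  faa : ∀ u ∈ eigSp F a α, ∀ w ∈ eigSp F a α, u * w ∈ eigSp F a 1 ⊔ eigSp F a 0

/-- `u`-vector (eigenvalue 0) -/
def uu (α β l : F) (a M s : V) : V := (α - β) • M - (2 : F) • s + (2 * ((1 - α) * l - β)) • a
/-- `v`-vector (eigenvalue alpha) -/
def vv (α β l : F) (a M s : V) : V := (2 : F) • s + β • M + (2 * (β - l)) • a

theorem uv_core {α β : F} (P : Par α β) {a x y s : V} {l : F} (h : PAx α β a)
    (hd : x - y ∈ eigSp F a β) (hp : x + y ∈ eigSp F a 1 ⊔ eigSp F a 0 ⊔ eigSp F a α)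
    (hl : HasProj F α β a x l) (hs : s = a * x - β • (a + x)) :
    uu α β l a (x + y) s ∈ eigSp F a 0 ∧ vv α β l a (x + y) s ∈ eigSp F a α := by
  obtain ⟨y', hy', eα, hα, e⟩ := Submodule.mem_sup.1 hp
  obtain ⟨e1, h1, e0, h0, e'⟩ := Submodule.mem_sup.1 hy'
  have h1p : HasProj F α β a e1 (2 * l) := by
    refine ((((hl.smul 2).sub (HasProj.ezero h0)).sub (HasProj.ealpha hα)).sub
      (HasProj.ebeta hd)).congr ?_ (by ring)
    linear_combination (norm := module) -e - e'
  have e1e := h1p.one_eq P h1 h.idem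
  have hv : vv α β l a (x + y) s = α • eα := by
    rw [mem_eig] at *
    have k1 := congrArg (a * ·) e
    have k2 := congrArg (a * ·) e'
    simp only [mul_add, h1, h0, hα] at k1 k2
    simp only [mul_sub] at hd
    unfold vv
    rw [hs]
    linear_combination (norm := module) hd - k1 - k2 + e1e
  have hu : uu α β l a (x + y) s = α • e0 := by
    have : uu α β l a (x + y) s = α • (x + y) - (2 * α * l) • a - vv α β l a (x + y) s := by
      unfold uu vv; module
    rw [this, hv]
    linear_combination (norm := module) (-α) • e - α • e' + α • e1e
  rw [hu, hv]
  exact ⟨Submodule.smul_mem _ _ h0, Submodule.smul_mem _ _ hα⟩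

theorem uv_sum (α β l : F) (a M s : V) :
    α • M = (2 * α * l) • a + uu α β l a M s + vv α β l a M s := by
  unfold uu vv; module

theorem lemB {α β : F} (P : Par α β) {a u u' v' M' : V} {l' : F} (h : PAx α β a)
    (hu : u ∈ eigSp F a 0) (hu' : u' ∈ eigSp F a 0) (hv' : v' ∈ eigSp F a α)
    (e : α • M' = (2 * α * l') • a + u' + v') :
    u * v' = a * (u * M') ∧ HasProj F α β a (u * M') 0 := by
  have h1 := h.f00 u hu u' hu'
  have h2 := h.f0a u hu v' hv'
  have e1 : α • (u * M') = u * u' + u * v' := by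
    have : α • (u * M') = u * (α • M') := by rw [mul_smul_comm]
    rw [this, e, mul_add, mul_add, mul_smul_comm, mul_comm u a, mem_eig.1 hu]; module
  constructor
  · have e2 := congrArg (a * ·) e1
    simp only [mul_add, mem_eig.1 h1, mem_eig.1 h2, mul_smul_comm] at e2
    have : α • (u * v' - a * (u * M')) = 0 := by
      linear_combination (norm := module) -e2
    exact sub_eq_zero.1 ((smul_eq_zero.1 this).resolve_left P.a0)
  · refine (((HasProj.ezero h1).add (HasProj.ealpha h2)).smul (α⁻¹)).congr ?_ (by ring)
    rw [← e1, smul_smul, inv_mul_cancel₀ P.a0, one_smul]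

theorem lemA {α β : F} (P : Par α β) {a u v M u' v' M' : V} {l l' lm : F} (h : PAx α β a)
    (hu : u ∈ eigSp F a 0) (hv : v ∈ eigSp F a α)
    (hu' : u' ∈ eigSp F a 0) (hv' : v' ∈ eigSp F a α)
    (e0 : α • M = (2 * α * l) • a + u + v)
    (e : α • M' = (2 * α * l') • a + u' + v') (hlm : HasProj F α β a (v * M') lm) :
    a * (v * M') = (2 * l' * α ^ 2) • v + a * (u' * M) + lm • a := by
  have hB := (lemB P h hu' hu hv e0).1
  obtain ⟨z, hz, w, hw, ez⟩ := Submodule.mem_sup.1 (h.faa v hv v' hv')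
  have h2 := h.f0a u' hu' v hv
  have e1 : α • (v * M') = (2 * α ^ 2 * l') • v + u' * v + v * v' := by
    have : α • (v * M') = v * (α • M') := by rw [mul_smul_comm]
    rw [this, e, mul_add, mul_add, mul_smul_comm, mul_comm v a, mem_eig.1 hv, mul_comm v u']; module
  have hzl : HasProj F α β a z (α * lm) := by
    refine ((((hlm.smul α).sub ((HasProj.ealpha hv).smul (2 * α ^ 2 * l'))).sub
      (HasProj.ealpha h2)).sub (HasProj.ezero hw)).congr ?_ (by ring)
    linear_combination (norm := module) e1 - ez
  have hze := hzl.one_eq P hz h.idem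
  have e2 := congrArg (a * ·) e1
  have e3 := congrArg (a * ·) ez
  simp only [mul_add, mem_eig.1 hz, mem_eig.1 hw, mem_eig.1 hv, mem_eig.1 h2, mul_smul_comm] at e2 e3
  have : α • (a * (v * M') - ((2 * l' * α ^ 2) • v + a * (u' * M) + lm • a)) = 0 := by
    linear_combination (norm := module) e2 - e3 + hze + α • hB
  exact sub_eq_zero.1 ((smul_eq_zero.1 this).resolve_left P.a0)

def cc (α β l : F) : F := (1 - α) * l - β
def dd (α β l : F) : F := β * (α - β) + cc α β l

/-- a triple `(a, M, S)` coming from an axis `a` and a symmetric pair with sum `M` -/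
structure Tri (α β l : F) (a M S : V) : Prop where
  u0 : (α - β) • M - S + (2 * cc α β l) • a ∈ eigSp F a 0
  va : S + β • M + (2 * (β - l)) • a ∈ eigSp F a α

theorem Tri.hM {α β l : F} {a M S : V} (T : Tri α β l a M S) (h : PAx α β a) (P : Par α β) :
    a * M = S + (2 * β) • a + β • M := by
  have h1 := mem_eig.1 T.u0
  have h2 := mem_eig.1 T.va
  simp only [mul_add, mul_sub, mul_smul_comm, h.idem, cc] at h1 h2
  have : α • (a * M - (S + (2 * β) • a + β • M)) = 0 := by
    linear_combination (norm := module) h1 + h2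
  exact sub_eq_zero.1 ((smul_eq_zero.1 this).resolve_left P.a0)

theorem Tri.hS {α β l : F} {a M S : V} (T : Tri α β l a M S) (h : PAx α β a) (P : Par α β) :
    a * S = (α - β) • S + (β * (α - β)) • M + (2 * dd α β l) • a := by
  have h1 := mem_eig.1 T.u0
  have h2 := T.hM h P
  simp only [mul_add, mul_sub, mul_smul_comm, h.idem, cc] at h1
  unfold dd cc
  linear_combination (norm := module) -h1 + (α - β) • h2

theorem Tri.pM {α β l : F} {a M S : V} (T : Tri α β l a M S) (P : Par α β) :
    HasProj F α β a M (2 * l) := by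
  refine (((HasProj.ezero T.u0).add (HasProj.ealpha T.va)).smul α⁻¹ |>.add
    (HasProj.self.smul (2 * l))).congr ?_ (by ring)
  have e : (α - β) • M - S + (2 * cc α β l) • a + (S + β • M + (2 * (β - l)) • a)
      = α • (M - (2 * l) • a) := by unfold cc; module
  rw [e, smul_smul, inv_mul_cancel₀ P.a0]; module

theorem Tri.pS {α β l : F} {a M S : V} (T : Tri α β l a M S) (P : Par α β) :
    HasProj F α β a S (2 * (l - β - β * l)) := by
  refine (((HasProj.ealpha T.va).sub ((T.pM P).smul β)).sub
    (HasProj.self.smul (2 * (β - l)))).congr ?_ (by ring)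
  module

theorem Tri.sum {α β l : F} {a M S : V} :
    α • M = (2 * α * l) • a + ((α - β) • M - S + (2 * cc α β l) • a)
      + (S + β • M + (2 * (β - l)) • a) := by
  unfold cc; module

theorem HasProj.div {α β c : F} {a x : V} {l : F} (hc : c ≠ 0) (h : HasProj F α β a (c • x) (c * l)) :
    HasProj F α β a x l := by
  refine (h.smul c⁻¹).congr ?_ ?_
  · rw [smul_smul, inv_mul_cancel₀ hc, one_smul]
  · rw [← mul_assoc, inv_mul_cancel₀ hc, one_mul]

/-- first level computation -/
theorem lev1 {α β l1 l2 : F} (P : Par α β) {a M1 M2 S1 S2 X : V} (h : PAx α β a)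
    (T1 : Tri α β l1 a M1 S1) (T2 : Tri α β l2 a M2 S2)
    (hMM : M1 * M1 = (1 + 2 * β) • M1 + X)
    (hSM : S1 * M1 = (2 * (α - β)) • S1 + (β * (α - β)) • ((2 : F) • a + M2)
      + (2 * dd α β l1) • M1) :
    HasProj F α β a X (2 * (l1 - β - 2 * β * l1 + β * l2)) ∧
    (2 * β - α) • (a * X) + (4*β^3-2*α*β^2-2*β^2-8*α*β*l1+4*β*l1+4*α^2*β-α*β) • M1
      + (2*β^2*(α-β)) • M2
      + (4*β^3-16*α*β*l1+8*β*l1-2*α*β*l2+8*α^2*β-4*α*β+16*α*l1^2-8*l1^2-8*α^2*l1+4*α*l1) • a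
      + (4*β^2-2*α*β-2*β-8*α*l1+4*l1+4*α^2-α) • S1 + (2*β*(α-β)) • S2 = 0 ∧
    -(S1 * S1) + (β - α) • (a * X) + (β*(α-β)) • X + (β*(α-β)) • S2
      + (4*β^3-8*α*β^2+2*β^2+2*α*β*l1-2*β*l1+4*α^2*β-2*α*β-2*α^2*l1+2*α*l1) • M1
      + (β*(α-β)^2) • M2
      + (6*β^3-12*α*β^2+4*β^2+4*α*β*l1-4*β*l1+6*α^2*β-4*α*β-4*α^2*l1+4*α*l1) • a
      + (6*β^2-10*α*β-β-2*α*l1+2*l1+4*α^2-α) • S1 = 0 := by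
  have m1 := T1.hM h P
  have s1 := T1.hS h P
  have m2 := T2.hM h P
  have s2 := T2.hS h P
  have pm1 := T1.pM P
  have ps1 := T1.pS P
  have pm2 := T2.pM P
  obtain ⟨b1, b2⟩ := lemB P h T1.u0 T1.u0 T1.va Tri.sum
  have hma : M1 * a = S1 + (2 * β) • a + β • M1 := by rw [mul_comm]; exact m1
  have hsa : S1 * a = (α - β) • S1 + (β * (α - β)) • M1 + (2 * dd α β l1) • a := by
    rw [mul_comm]; exact s1
  have hms : M1 * S1 = (2 * (α - β)) • S1 + (β * (α - β)) • ((2 : F) • a + M2)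
      + (2 * dd α β l1) • M1 := by rw [mul_comm]; exact hSM
  have pX : HasProj F α β a X (2 * (l1 - β - 2 * β * l1 + β * l2)) := by
    refine HasProj.div (sub_ne_zero.2 P.ab) ?_
    simp only [add_mul, sub_mul, smul_mul_assoc, hMM, hSM, m1] at b2
    refine (((((b2.sub (pm1.smul ((α-β)*(1+2*β)-2*dd α β l1 + 2*β*cc α β l1))).add
      (ps1.smul (2*(α-β)-2*cc α β l1))).add (pm2.smul (β*(α-β)))).add
      (HasProj.self.smul (2*β*(α-β)-4*β*cc α β l1)))).congr ?_ ?_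
    · unfold dd cc; module
    · unfold dd cc; ring
  refine ⟨pX, ?_, ?_⟩
  · have pv : HasProj F α β a ((S1 + β • M1 + (2 * (β - l1)) • a) * M1)
      ((2*(α-β)+2*(β-l1)) * (2 * (l1 - β - β * l1)) + β*(α-β)*(2+2*l2)
        + (2*dd α β l1+β*(1+2*β)+2*(β-l1)*β)*(2*l1)
        + β*(2 * (l1 - β - 2 * β * l1 + β * l2)) + 4*(β-l1)*β) := by
      simp only [add_mul, sub_mul, smul_mul_assoc, hMM, hSM, m1]
      refine (((((ps1.smul (2*(α-β)+2*(β-l1))).add (pm2.smul (β*(α-β)))).add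
        (pm1.smul (2*dd α β l1+β*(1+2*β)+2*(β-l1)*β))).add (pX.smul β)).add
        (HasProj.self.smul (2*β*(α-β)+4*(β-l1)*β))).congr ?_ ?_
      · module
      · ring
    have A := lemA P h T1.u0 T1.va T1.u0 T1.va Tri.sum Tri.sum pv
    simp only [add_mul, sub_mul, smul_mul_assoc, hMM, hSM, m1, mul_add, mul_sub, mul_smul_comm,
      m2, s1, h.idem] at A
    unfold dd cc at A
    linear_combination (norm := module) A
  · simp only [add_mul, sub_mul, smul_mul_assoc, hMM, hSM, hms, hma, hsa, m1, mul_add, mul_sub, mul_smul_comm,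
      m2, s1, h.idem] at b1
    unfold dd cc at b1
    linear_combination (norm := module) b1

/-- doubled `s_{r,n}` -/
def SS (β : F) (a : ℤ → V) (r n : ℤ) : V := (2 : F) • (a r * a (r + n)) - (2 * β) • (a r + a (r + n))

structure Pre (α β l1 l2 : F) (a : ℤ → V) : Prop where
  ax : ∀ i, PAx α β (a i)
  anti : ∀ i n, a (i + n) - a (i - n) ∈ eigSp F (a i) β
  plus : ∀ i n, a (i + n) + a (i - n) ∈ eigSp F (a i) 1 ⊔ eigSp F (a i) 0 ⊔ eigSp F (a i) α
  p1 : ∀ i, HasProj F α β (a i) (a (i + 1)) l1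
  p2 : ∀ i, HasProj F α β (a i) (a (i + 2)) l2

theorem Pre.projneg {α β l1 l2 : F} {a : ℤ → V} (H : Pre α β l1 l2 a) {i n : ℤ} {l : F}
    (h : HasProj F α β (a i) (a (i + n)) l) : HasProj F α β (a i) (a (i - n)) l :=
  (h.sub (HasProj.ebeta (H.anti i n))).congr (by module) (by ring)

theorem Pre.projneg' {α β l1 l2 : F} {a : ℤ → V} (H : Pre α β l1 l2 a) {i n : ℤ} {l : F}
    (h : HasProj F α β (a i) (a (i - n)) l) : HasProj F α β (a i) (a (i + n)) l :=
  (h.add (HasProj.ebeta (H.anti i n))).congr (by module) (by ring)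

theorem Pre.shift {α β l1 l2 : F} {a : ℤ → V} (H : Pre α β l1 l2 a) (k : ℤ) :
    Pre α β l1 l2 (fun i => a (i + k)) where
  ax i := H.ax _
  anti i n := by
    have := H.anti (i + k) n
    rwa [show i + k + n = i + n + k by ring, show i + k - n = i - n + k by ring] at this
  plus i n := by
    have := H.plus (i + k) n
    rwa [show i + k + n = i + n + k by ring, show i + k - n = i - n + k by ring] at this
  p1 i := by
    have := H.p1 (i + k)
    rwa [show i + k + 1 = i + 1 + k by ring] at this
  p2 i := by
    have := H.p2 (i + k)
    rwa [show i + k + 2 = i + 2 + k by ring] at this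

theorem Pre.refl {α β l1 l2 : F} {a : ℤ → V} (H : Pre α β l1 l2 a) :
    Pre α β l1 l2 (fun i => a (-i)) where
  ax i := H.ax _
  anti i n := by
    have := H.anti (-i) (-n)
    rwa [show -i + -n = -(i + n) by ring, show -i - -n = -(i - n) by ring] at this
  plus i n := by
    have := H.plus (-i) (-n)
    rwa [show -i + -n = -(i + n) by ring, show -i - -n = -(i - n) by ring] at this
  p1 i := by
    have := H.projneg (H.p1 (-i))
    rwa [show -i - 1 = -(i + 1) by ring] at this
  p2 i := by
    have := H.projneg (H.p2 (-i))
    rwa [show -i - 2 = -(i + 2) by ring] at this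

theorem Pre.SS_sub {α β l1 l2 : F} {a : ℤ → V} (H : Pre α β l1 l2 a) (r n : ℤ) :
    SS β a r n = (2 : F) • (a r * a (r - n)) - (2 * β) • (a r + a (r - n)) := by
  have := mem_eig.1 (H.anti r n)
  rw [mul_sub] at this
  unfold SS
  linear_combination (norm := module) (2 : F) • this

theorem Pre.SS_step {α β l1 l2 : F} {a : ℤ → V} (H : Pre α β l1 l2 a) (r n : ℤ) :
    SS β a (r + n) n = SS β a r n := by
  rw [H.SS_sub (r + n) n, add_sub_cancel_right, mul_comm, SS]
  module

theorem Pre.SS_step' {α β l1 l2 : F} {a : ℤ → V} (H : Pre α β l1 l2 a) (r n : ℤ) :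
    SS β a (r - n) n = SS β a r n := by
  have := H.SS_step (r - n) n
  rw [sub_add_cancel] at this; exact this.symm

theorem Pre.SS1 {α β l1 l2 : F} {a : ℤ → V} (H : Pre α β l1 l2 a) (r : ℤ) :
    SS β a r 1 = SS β a 0 1 := by
  induction r using Int.induction_on with
  | zero => rfl
  | succ i ih => rw [← ih]; exact H.SS_step _ _
  | pred i ih => rw [← ih]; exact H.SS_step' _ _

theorem Pre.tri {α β l1 l2 : F} {a : ℤ → V} (P : Par α β) (H : Pre α β l1 l2 a) {i n : ℤ} {l : F}
    (h : HasProj F α β (a i) (a (i + n)) l) :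
    Tri α β l (a i) (a (i + n) + a (i - n)) (SS β a i n) := by
  obtain ⟨h1, h2⟩ := uv_core P (H.ax i) (H.anti i n) (H.plus i n) h rfl
  refine ⟨?_, ?_⟩
  · convert h1 using 1; unfold uu SS cc; module
  · convert h2 using 1; unfold vv SS; module

theorem Pre.tri1 {α β l1 l2 : F} {a : ℤ → V} (P : Par α β) (H : Pre α β l1 l2 a) (i : ℤ) :
    Tri α β l1 (a i) (a (i + 1) + a (i - 1)) (SS β a 0 1) := by
  rw [← H.SS1 i]; exact H.tri P (H.p1 i)

theorem Pre.aS1 {α β l1 l2 : F} {a : ℤ → V} (P : Par α β) (H : Pre α β l1 l2 a) (i : ℤ) :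
    a i * SS β a 0 1 = (α - β) • SS β a 0 1 + (β * (α - β)) • (a (i + 1) + a (i - 1))
      + (2 * dd α β l1) • a i := (H.tri1 P i).hS (H.ax i) P

def qm1 (α β l1 : F) : F := (2*β-α)*(4*β^3-8*α*β^2+2*β^2+2*α*β*l1-2*β*l1+4*α^2*β-2*α*β-2*α^2*l1+2*α*l1)
  + (α-β)*(4*β^3-2*α*β^2-2*β^2-8*α*β*l1+4*β*l1+4*α^2*β-α*β)
def qm0 (α β l1 l2 : F) : F :=
  (2*β-α)*(6*β^3-12*α*β^2+4*β^2+4*α*β*l1-4*β*l1+6*α^2*β-4*α*β-4*α^2*l1+4*α*l1)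
  + (α-β)*(4*β^3-16*α*β*l1+8*β*l1-2*α*β*l2+8*α^2*β-4*α*β+16*α*l1^2-8*l1^2-8*α^2*l1+4*α*l1)

theorem Pre.level1 {α β l1 l2 : F} {a : ℤ → V} (P : Par α β) (H : Pre α β l1 l2 a) (i : ℤ) :
    HasProj F α β (a i) (SS β a (i - 1) 2) (2 * (l1 - β - 2 * β * l1 + β * l2)) ∧
    (2 * β - α) • (a i * SS β a (i - 1) 2)
      + (4*β^3-2*α*β^2-2*β^2-8*α*β*l1+4*β*l1+4*α^2*β-α*β) • (a (i + 1) + a (i - 1))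
      + (2*β^2*(α-β)) • (a (i + 2) + a (i - 2))
      + (4*β^3-16*α*β*l1+8*β*l1-2*α*β*l2+8*α^2*β-4*α*β+16*α*l1^2-8*l1^2-8*α^2*l1+4*α*l1) • a i
      + (4*β^2-2*α*β-2*β-8*α*l1+4*l1+4*α^2-α) • SS β a 0 1 + (2*β*(α-β)) • SS β a i 2 = 0 ∧
    -(SS β a 0 1 * SS β a 0 1) + (β - α) • (a i * SS β a (i - 1) 2) + (β*(α-β)) • SS β a (i - 1) 2
      + (β*(α-β)) • SS β a i 2
      + (4*β^3-8*α*β^2+2*β^2+2*α*β*l1-2*β*l1+4*α^2*β-2*α*β-2*α^2*l1+2*α*l1) • (a (i + 1) + a (i - 1))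
      + (β*(α-β)^2) • (a (i + 2) + a (i - 2))
      + (6*β^3-12*α*β^2+4*β^2+4*α*β*l1-4*β*l1+6*α^2*β-4*α*β-4*α^2*l1+4*α*l1) • a i
      + (6*β^2-10*α*β-β-2*α*l1+2*l1+4*α^2-α) • SS β a 0 1 = 0 := by
  refine lev1 P (H.ax i) (H.tri1 P i) (H.tri P (H.p2 i)) ?_ ?_
  · have e1 := (H.ax (i + 1)).idem
    have e2 := (H.ax (i - 1)).idem
    unfold SS
    rw [show i - 1 + 2 = i + 1 by ring]
    simp only [mul_add, add_mul, e1, e2, mul_comm (a (i + 1)) (a (i - 1))]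
    module
  · have e1 := H.aS1 P (i + 1)
    have e2 := H.aS1 P (i - 1)
    rw [show i + 1 + 1 = i + 2 by ring, show i + 1 - 1 = i by ring] at e1
    rw [show i - 1 + 1 = i by ring, show i - 1 - 1 = i - 2 by ring] at e2
    rw [mul_comm, add_mul, e1, e2]
    module

theorem Pre.relC {α β l1 l2 : F} {a : ℤ → V} (P : Par α β) (H : Pre α β l1 l2 a) (i : ℤ) :
    (2 * β * (α - β) ^ 2) • (SS β a i 2 - SS β a (i + 1) 2)
     + (β * (α - β) ^ 2 * (4 * β - α)) • (a (i - 2) - a (i + 3))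
     + (qm1 α β l1 - β * (α - β) ^ 2 * (4 * β - α)) • (a (i - 1) - a (i + 2))
     + (qm0 α β l1 l2 - qm1 α β l1) • (a i - a (i + 1)) = 0 := by
  obtain ⟨-, A, B⟩ := H.level1 P i
  obtain ⟨-, A', B'⟩ := H.level1 P (i + 1)
  have e := H.SS_step' (i + 1) 2
  rw [show i + 1 - 2 = i - 1 by ring] at e
  rw [e] at A B
  rw [show i + 1 - 1 = i by ring, show i + 1 + 1 = i + 2 by ring, show i + 1 + 2 = i + 3 by ring,
    show i + 1 - 2 = i - 1 by ring] at A' B'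
  unfold qm0 qm1
  linear_combination (norm := module) (2 * β - α) • (B - B') + (α - β) • (A - A')

/-- window of seven consecutive axes -/
def Wn (F : Type u) [Field F] {V : Type v} [NonUnitalNonAssocCommRing V] [Module F V]
    (a : ℤ → V) (i : ℤ) : Submodule F V := Submodule.span F (a '' Set.Icc (i - 3) (i + 3))

theorem memWn {a : ℤ → V} {i : ℤ} (j : ℤ) (h1 : i - 3 ≤ j) (h2 : j ≤ i + 3) : a j ∈ Wn F a i :=
  Submodule.subset_span ⟨j, ⟨h1, h2⟩, rfl⟩

theorem mem_of_comb {T : Submodule F V} {x y : V} {c : F} (hc : c ≠ 0) (hy : y ∈ T)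
    (e : c • x = y) : x ∈ T := by
  have : x = c⁻¹ • y := by rw [← e, smul_smul, inv_mul_cancel₀ hc, one_smul]
  rw [this]; exact T.smul_mem _ hy

theorem memWn_of {a : ℤ → V} {i : ℤ} {x : V} {c : F} (c3 c2 c1 c0 d1 d2 d3 : F) (hc : c ≠ 0)
    (e : c • x = c3 • a (i + 3) + c2 • a (i + 2) + c1 • a (i + 1) + c0 • a i + d1 • a (i - 1)
      + d2 • a (i - 2) + d3 • a (i - 3)) : x ∈ Wn F a i := by
  refine mem_of_comb hc ?_ e
  have m := fun j h1 h2 (c : F) => (Wn F a i).smul_mem c (memWn (F := F) (a := a) (i := i) j h1 h2)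
  refine add_mem (add_mem (add_mem (add_mem (add_mem (add_mem ?_ ?_) ?_) ?_) ?_) ?_) ?_ <;>
  exact m _ (by omega) (by omega) _

theorem Wn_refl {a : ℤ → V} {i : ℤ} : Wn F (fun i => a (-i)) i = Wn F a (-i) := by
  unfold Wn
  congr 1
  ext x
  constructor
  · rintro ⟨j, ⟨h1, h2⟩, rfl⟩
    exact ⟨-j, ⟨by omega, by omega⟩, rfl⟩
  · rintro ⟨j, ⟨h1, h2⟩, rfl⟩
    exact ⟨-j, ⟨by omega, by omega⟩, by simp⟩

theorem range_le_Wn {a : ℤ → V} (rp : ∀ i, a (i + 4) ∈ Wn F a i) (rm : ∀ i, a (i - 4) ∈ Wn F a i)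
    (i : ℤ) : Submodule.span F (Set.range a) = Wn F a i := by
  have st : ∀ i, Wn F a (i + 1) = Wn F a i := by
    intro i
    apply le_antisymm
    · refine Submodule.span_le.2 ?_
      rintro _ ⟨j, ⟨h1, h2⟩, rfl⟩
      rcases (by omega : j = i + 4 ∨ j ≤ i + 3) with h | h
      · subst h; exact rp i
      · exact memWn j (by omega) h
    · refine Submodule.span_le.2 ?_
      rintro _ ⟨j, ⟨h1, h2⟩, rfl⟩
      rcases (by omega : j = i + 1 - 4 ∨ i - 2 ≤ j) with h | h
      · subst h; exact rm _
      · exact memWn j (by omega) (by omega)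
  have all : ∀ i, Wn F a i = Wn F a 0 := by
    intro i
    induction i using Int.induction_on with
    | zero => rfl
    | succ i ih => rw [st, ih]
    | pred i ih => rw [← ih, ← st (-i - 1)]; congr 1; ring
  apply le_antisymm
  · refine Submodule.span_le.2 ?_
    rintro _ ⟨j, rfl⟩
    rw [all i, ← all j]
    exact memWn j (by omega) (by omega)
  · refine Submodule.span_mono ?_
    rintro _ ⟨j, _, rfl⟩; exact ⟨j, rfl⟩

def Good (α β : F) (a0 a1 : V) : Prop :=
  ∃ T : Submodule F V, a0 ∈ T ∧ a1 ∈ T ∧ (∀ x ∈ T, ∀ y ∈ T, x * y ∈ T) ∧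
    (∀ x ∈ T, ∃ l, HasProj F α β a0 x l)

def TT (β : F) (a : ℤ → V) (N : Set ℤ) : Submodule F V :=
  Submodule.span F (Set.range a) ⊔ Submodule.span F ((fun n => SS β a 0 n) '' N)

theorem mul_span_mem {T : Submodule F V} {S S' : Set V} {x y : V}
    (h : ∀ s ∈ S, ∀ t ∈ S', s * t ∈ T) (hx : x ∈ Submodule.span F S)
    (hy : y ∈ Submodule.span F S') : x * y ∈ T := by
  induction hx using Submodule.span_induction with
  | mem s hs =>
    induction hy using Submodule.span_induction with
    | mem t ht => exact h s hs t ht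
    | zero => simp
    | add x y _ _ h1 h2 => rw [mul_add]; exact add_mem h1 h2
    | smul c x _ h1 => rw [mul_smul_comm]; exact T.smul_mem _ h1
  | zero => simp
  | add x y _ _ h1 h2 => rw [add_mul]; exact add_mem h1 h2
  | smul c x _ h1 => rw [smul_mul_assoc]; exact T.smul_mem _ h1

theorem Pre.ex_proj {α β l1 l2 : F} {a : ℤ → V} (H : Pre α β l1 l2 a)
    (rp : ∀ i, a (i + 4) ∈ Wn F a i) (rm : ∀ i, a (i - 4) ∈ Wn F a i)
    (h3p : ∀ i, ∃ l, HasProj F α β (a i) (a (i + 3)) l) (i : ℤ) (x : V)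
    (hx : x ∈ Submodule.span F (Set.range a)) : ∃ l, HasProj F α β (a i) x l := by
  rw [range_le_Wn rp rm i] at hx
  unfold Wn at hx
  induction hx using Submodule.span_induction with
  | mem s hs =>
    obtain ⟨j, ⟨h1, h2⟩, rfl⟩ := hs
    have : j = i - 3 ∨ j = i - 2 ∨ j = i - 1 ∨ j = i ∨ j = i + 1 ∨ j = i + 2 ∨ j = i + 3 := by omega
    obtain ⟨l3, h3⟩ := h3p i
    rcases this with h | h | h | h | h | h | h <;> subst h
    · exact ⟨_, H.projneg h3⟩
    · exact ⟨_, H.projneg (H.p2 i)⟩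
    · exact ⟨_, H.projneg (H.p1 i)⟩
    · exact ⟨_, HasProj.self⟩
    · exact ⟨_, H.p1 i⟩
    · exact ⟨_, H.p2 i⟩
    · exact ⟨_, h3⟩
  | zero => exact ⟨0, HasProj.ezero (Submodule.zero_mem _)⟩
  | add x y _ _ h1 h2 =>
    obtain ⟨l, h1⟩ := h1
    obtain ⟨m, h2⟩ := h2
    exact ⟨_, h1.add h2⟩
  | smul c x _ h1 =>
    obtain ⟨l, h1⟩ := h1
    exact ⟨_, h1.smul c⟩

theorem Pre.finish {α β l1 l2 : F} {a : ℤ → V} (P : Par α β) (H : Pre α β l1 l2 a) (N : Set ℤ)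
    (hN : ∀ n ∈ N, n = 1 ∨ n = 2 ∨ n = 3) (h1N : (1 : ℤ) ∈ N) (h2N : (2 : ℤ) ∈ N)
    (rp : ∀ i, a (i + 4) ∈ Wn F a i) (rm : ∀ i, a (i - 4) ∈ Wn F a i)
    (hs : ∀ r, ∀ n ∈ N, n ≠ 1 → SS β a (r + 1) n - SS β a r n ∈
      Submodule.span F (Set.range a) ⊔ Submodule.span F {SS β a 0 1})
    (h3 : ∀ i, a i * a (i + 3) ∈ TT β a N)
    (h3p : ∀ i, ∃ l, HasProj F α β (a i) (a (i + 3)) l) : Good α β (a 0) (a 1) := by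
  set A := Submodule.span F (Set.range a) with hA
  set T := TT β a N with hT
  have AT : A ≤ T := le_sup_left
  have hpr := H.ex_proj rp rm h3p
  have am : ∀ j, a j ∈ A := fun j => Submodule.subset_span ⟨j, rfl⟩
  have amT : ∀ j, a j ∈ T := fun j => AT (am j)
  have s0T : ∀ n ∈ N, SS β a 0 n ∈ T := fun n hn =>
    Submodule.mem_sup_right (Submodule.subset_span ⟨n, hn, rfl⟩)
  have A1T : A ⊔ Submodule.span F {SS β a 0 1} ≤ T := by
    refine sup_le AT (Submodule.span_le.2 ?_)
    rintro _ rfl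
    exact s0T 1 h1N
  have hs' : ∀ n ∈ N, ∀ r, SS β a r n - SS β a 0 n ∈ A ⊔ Submodule.span F {SS β a 0 1} := by
    intro n hn r
    by_cases h : n = 1
    · subst h; rw [H.SS1 r, sub_self]; exact zero_mem _
    induction r using Int.induction_on with
    | zero => rw [sub_self]; exact zero_mem _
    | succ i ih => convert add_mem (hs i n hn h) ih using 1; abel
    | pred i ih =>
      convert sub_mem ih (hs (-i - 1) n hn h) using 1
      rw [show -(i : ℤ) - 1 + 1 = -i by ring]; abel
  have ssT : ∀ n ∈ N, ∀ r, SS β a r n ∈ T := by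
    intro n hn r
    convert add_mem (A1T (hs' n hn r)) (s0T n hn) using 1; abel
  have prodT : ∀ n ∈ N, ∀ r, a r * a (r + n) ∈ T := by
    intro n hn r
    refine mem_of_comb (c := 2) P.two
      (add_mem (ssT n hn r) (T.smul_mem (2 * β) (add_mem (amT r) (amT (r + n))))) ?_
    unfold SS; module
  have prodT' : ∀ n, ∀ r, a r * a (r + n) ∈ T → a r * a (r - n) ∈ T := by
    intro n r h
    have := mem_eig.1 (H.anti r n)
    rw [mul_sub] at this
    convert sub_mem h (T.smul_mem β (sub_mem (amT (r + n)) (amT (r - n)))) using 1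
    linear_combination (norm := module) -this
  have aA : ∀ i, ∀ x ∈ A, a i * x ∈ T := by
    intro i x hx
    rw [hA, range_le_Wn rp rm i] at hx
    refine mul_span_mem (S := {a i}) ?_ (Submodule.subset_span rfl) hx
    rintro _ rfl _ ⟨j, ⟨h1, h2⟩, rfl⟩
    have : j = i - 3 ∨ j = i - 2 ∨ j = i - 1 ∨ j = i ∨ j = i + 1 ∨ j = i + 2 ∨ j = i + 3 := by omega
    rcases this with h | h | h | h | h | h | h <;> subst h
    · exact prodT' _ _ (h3 i)
    · exact prodT' _ _ (prodT _ h2N i)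
    · exact prodT' _ _ (prodT _ h1N i)
    · rw [(H.ax j).idem]; exact amT j
    · exact prodT _ h1N i
    · exact prodT _ h2N i
    · exact h3 i
  have trin : ∀ n, ∀ i, ∃ l, Tri α β l (a i) (a (i + n) + a (i - n)) (SS β a i n) := by
    intro n i
    obtain ⟨l, hl⟩ := hpr i (a (i + n)) (am _)
    exact ⟨l, H.tri P hl⟩
  have aSi : ∀ n ∈ N, ∀ i, a i * SS β a i n ∈ T := by
    intro n hn i
    obtain ⟨l, tr⟩ := trin n i
    rw [tr.hS (H.ax i) P]
    exact add_mem (add_mem (T.smul_mem _ (ssT n hn i)) (T.smul_mem _ (add_mem (amT _) (amT _))))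
      (T.smul_mem _ (amT _))
  have aA1 : ∀ i, ∀ x ∈ A ⊔ Submodule.span F {SS β a 0 1}, a i * x ∈ T := by
    intro i x hx
    obtain ⟨y, hy, z, hz, rfl⟩ := Submodule.mem_sup.1 hx
    obtain ⟨c, rfl⟩ := Submodule.mem_span_singleton.1 hz
    rw [mul_add, mul_smul_comm]
    refine add_mem (aA i y hy) (T.smul_mem _ ?_)
    rw [← H.SS1 i]; exact aSi 1 h1N i
  have aS : ∀ n ∈ N, ∀ i, a i * SS β a 0 n ∈ T := by
    intro n hn i
    have := sub_mem (aSi n hn i) (aA1 i _ (hs' n hn i))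
    rwa [← mul_sub, sub_sub_cancel] at this
  have aT : ∀ i, ∀ x ∈ T, a i * x ∈ T := by
    intro i x hx
    obtain ⟨y, hy, z, hz, rfl⟩ := Submodule.mem_sup.1 hx
    rw [mul_add]
    refine add_mem (aA i y hy) ?_
    refine mul_span_mem (S := {a i}) ?_ (Submodule.subset_span rfl) hz
    rintro _ rfl _ ⟨n, hn, rfl⟩
    exact aS n hn i
  have AT' : ∀ x ∈ A, ∀ y ∈ T, x * y ∈ T := by
    intro x hx y hy
    refine mul_span_mem (S' := {y}) ?_ hx (Submodule.subset_span rfl)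
    rintro _ ⟨i, rfl⟩ _ rfl
    exact aT i _ hy
  have ST : ∀ n ∈ N, ∀ m ∈ N, SS β a 0 n * SS β a 0 m ∈ T := by
    intro n hn m hm
    obtain ⟨l, t⟩ := trin n 0
    obtain ⟨l', t'⟩ := trin m 0
    set S := SS β a 0 n
    set S' := SS β a 0 m
    have hS := s0T n hn
    have hS' := s0T m hm
    have k0 := (H.ax 0).f00 _ t.u0 _ t'.u0
    have ka := (H.ax 0).f0a _ t.u0 _ t'.va
    obtain ⟨x, hx, ex⟩ : ∃ x ∈ A, x = (α - β) • (a (0 + n) + a (0 - n)) + (2 * cc α β l) • a 0 :=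
      ⟨_, add_mem (A.smul_mem _ (add_mem (am _) (am _))) (A.smul_mem _ (am _)), rfl⟩
    obtain ⟨x', hx', ex'⟩ : ∃ x ∈ A, x = (α - β) • (a (0 + m) + a (0 - m)) + (2 * cc α β l') • a 0 :=
      ⟨_, add_mem (A.smul_mem _ (add_mem (am _) (am _))) (A.smul_mem _ (am _)), rfl⟩
    obtain ⟨y', hy', ey'⟩ : ∃ x ∈ A, x = β • (a (0 + m) + a (0 - m)) + (2 * (β - l')) • a 0 :=
      ⟨_, add_mem (A.smul_mem _ (add_mem (am _) (am _))) (A.smul_mem _ (am _)), rfl⟩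
    have e1 : (α - β) • (a (0 + n) + a (0 - n)) - S + (2 * cc α β l) • a 0 = x - S := by
      rw [ex]; abel
    have e2 : (α - β) • (a (0 + m) + a (0 - m)) - S' + (2 * cc α β l') • a 0 = x' - S' := by
      rw [ex']; abel
    have e3 : S' + β • (a (0 + m) + a (0 - m)) + (2 * (β - l')) • a 0 = S' + y' := by
      rw [ey']; abel
    rw [e1, e2, mem_eig] at k0
    rw [e1, e3, mem_eig] at ka
    have q1 : x * x' - x * S' - x' * S ∈ T :=
      sub_mem (sub_mem (AT' _ hx _ (AT hx')) (AT' _ hx _ hS')) (AT' _ hx' _ hS)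
    have q2 : x * S' + x * y' - y' * S ∈ T :=
      sub_mem (add_mem (AT' _ hx _ hS') (AT' _ hx _ (AT hy'))) (AT' _ hy' _ hS)
    have r1 := aT 0 _ q1
    have r2 := aT 0 _ q2
    have f1 : (x - S) * (x' - S') = (x * x' - x * S' - x' * S) + S * S' := by
      simp only [sub_mul, mul_sub, mul_comm x' S]; abel
    have f2 : (x - S) * (S' + y') = (x * S' + x * y' - y' * S) - S * S' := by
      simp only [sub_mul, mul_add, mul_comm y' S]; abel
    rw [f1, mul_add] at k0
    rw [f2, mul_sub] at ka
    refine mem_of_comb P.a0 (sub_mem (sub_mem (T.smul_mem α q2) r2) r1) ?_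
    linear_combination (norm := module) ka + k0
  have TTm : ∀ x ∈ T, ∀ y ∈ T, x * y ∈ T := by
    intro x hx y hy
    obtain ⟨x1, h1, x2, h2, rfl⟩ := Submodule.mem_sup.1 hx
    obtain ⟨y1, g1, y2, g2, ey⟩ := Submodule.mem_sup.1 hy
    rw [add_mul]
    refine add_mem (AT' _ h1 _ hy) ?_
    rw [← ey, mul_add, mul_comm x2 y1]
    refine add_mem (AT' _ g1 _ (Submodule.mem_sup_right h2)) ?_
    refine mul_span_mem ?_ h2 g2
    rintro _ ⟨n, hn, rfl⟩ _ ⟨m, hm, rfl⟩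
    exact ST n hn m hm
  refine ⟨T, amT 0, amT 1, TTm, ?_⟩
  intro x hx
  obtain ⟨y, hy, z, hz, rfl⟩ := Submodule.mem_sup.1 hx
  obtain ⟨l, hl⟩ := hpr 0 y hy
  have : ∃ l, HasProj F α β (a 0) z l := by
    clear hx
    induction hz using Submodule.span_induction with
    | mem s hs =>
      obtain ⟨n, hn, rfl⟩ := hs
      obtain ⟨l, t⟩ := trin n 0
      exact ⟨_, t.pS P⟩
    | zero => exact ⟨0, HasProj.ezero (Submodule.zero_mem _)⟩
    | add x y hx hy h1 h2 =>
      obtain ⟨l, h1⟩ := h1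
      obtain ⟨m, h2⟩ := h2
      exact ⟨_, h1.add h2⟩
    | smul c x hx h1 =>
      obtain ⟨l, h1⟩ := h1
      exact ⟨_, h1.smul c⟩
  obtain ⟨m, hm⟩ := this
  exact ⟨_, hl.add hm⟩

theorem rm_of_refl {a : ℤ → V} (h : ∀ i, (fun j => a (-j)) (i + 4) ∈ Wn F (fun j => a (-j)) i) :
    ∀ i, a (i - 4) ∈ Wn F a i := by
  intro i
  have := h (-i)
  rw [Wn_refl, neg_neg] at this
  simpa [sub_eq_add_neg, add_comm] using this

/-- span of axes and `S1` -/
def AA (β : F) (a : ℤ → V) : Submodule F V :=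
  Submodule.span F (Set.range a) ⊔ Submodule.span F {SS β a 0 1}

theorem AA.mem {β : F} {a : ℤ → V} (i : ℤ) (c : F) : c • a i ∈ AA β a :=
  Submodule.smul_mem _ _ (Submodule.mem_sup_left (Submodule.subset_span ⟨i, rfl⟩))

theorem AA.memS {β : F} {a : ℤ → V} (c : F) : c • SS β a 0 1 ∈ AA β a :=
  Submodule.smul_mem _ _ (Submodule.mem_sup_right (Submodule.subset_span rfl))

theorem AA.leTT {β : F} {a : ℤ → V} {N : Set ℤ} (h : (1 : ℤ) ∈ N) : AA β a ≤ TT β a N :=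
  sup_le_sup le_rfl (Submodule.span_mono (by rintro _ rfl; exact ⟨1, h, rfl⟩))

theorem SS_diff {β : F} {a : ℤ → V} {n : ℤ}
    (hs : ∀ r, SS β a (r + 1) n - SS β a r n ∈ AA β a) (r : ℤ) :
    SS β a r n - SS β a 0 n ∈ AA β a := by
  induction r using Int.induction_on with
  | zero => rw [sub_self]; exact zero_mem _
  | succ i ih => convert add_mem (hs i) ih using 1; abel
  | pred i ih =>
    convert sub_mem ih (hs (-i - 1)) using 1
    rw [show -(i : ℤ) - 1 + 1 = -i by ring]; abel

theorem SS_TT {β : F} {a : ℤ → V} {n : ℤ} {N : Set ℤ} (h : (1 : ℤ) ∈ N) (hn : n ∈ N)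
    (hs : ∀ r, SS β a (r + 1) n - SS β a r n ∈ AA β a) (r : ℤ) : SS β a r n ∈ TT β a N := by
  have h0 : SS β a 0 n ∈ TT β a N := Submodule.mem_sup_right (Submodule.subset_span ⟨n, hn, rfl⟩)
  convert add_mem (AA.leTT h (SS_diff hs r)) h0 using 1; abel

theorem Pre.finish3 {α β l1 l2 : F} {a : ℤ → V} (P : Par α β) (H : Pre α β l1 l2 a)
    (rp : ∀ i, a (i + 4) ∈ Wn F a i) (rm : ∀ i, a (i - 4) ∈ Wn F a i)
    (hs2 : ∀ r, SS β a (r + 1) 2 - SS β a r 2 ∈ AA β a)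
    (hs3 : ∀ r, SS β a (r + 1) 3 - SS β a r 3 ∈ AA β a)
    (h3p : ∀ i, ∃ l, HasProj F α β (a i) (a (i + 3)) l) : Good α β (a 0) (a 1) := by
  refine H.finish P {1, 2, 3} ?_ (by simp) (by simp) rp rm ?_ ?_ h3p
  · intro n hn; simpa using hn
  · intro r n hn h
    simp only [Set.mem_insert_iff, Set.mem_singleton_iff] at hn
    rcases hn with h' | h' | h'
    · exact absurd h' h
    · subst h'; exact hs2 r
    · subst h'; exact hs3 r
  · intro i
    have h1 : (1 : ℤ) ∈ ({1, 2, 3} : Set ℤ) := by simp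
    have := SS_TT h1 (by simp) hs3 i
    refine mem_of_comb P.two (add_mem this (AA.leTT h1 (add_mem (AA.mem i (2 * β))
      (AA.mem (i + 3) (2 * β))))) ?_
    unfold SS; module

theorem Pre.finish2 {α β l1 l2 : F} {a : ℤ → V} (P : Par α β) (H : Pre α β l1 l2 a)
    (rp : ∀ i, a (i + 4) ∈ Wn F a i) (rm : ∀ i, a (i - 4) ∈ Wn F a i)
    (hs2 : ∀ r, SS β a (r + 1) 2 - SS β a r 2 ∈ AA β a)
    (h3 : ∀ i, a i * a (i + 3) ∈ TT β a {1, 2})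
    (h3p : ∀ i, ∃ l, HasProj F α β (a i) (a (i + 3)) l) : Good α β (a 0) (a 1) := by
  refine H.finish P {1, 2} ?_ (by simp) (by simp) rp rm ?_ h3 h3p
  · intro n hn; simp only [Set.mem_insert_iff, Set.mem_singleton_iff] at hn; tauto
  · intro r n hn h
    simp only [Set.mem_insert_iff, Set.mem_singleton_iff] at hn
    rcases hn with h' | h'
    · exact absurd h' h
    · subst h'; exact hs2 r

theorem Pre.prod12 {α β l1 l2 : F} {a : ℤ → V} (P : Par α β) (H : Pre α β l1 l2 a)
    (hs2 : ∀ r, SS β a (r + 1) 2 - SS β a r 2 ∈ AA β a) (i : ℤ) :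
    a i * a (i + 1) ∈ TT β a {1, 2} ∧ a i * a (i - 1) ∈ TT β a {1, 2} ∧
    a i * a (i + 2) ∈ TT β a {1, 2} := by
  have h1 : (1 : ℤ) ∈ ({1, 2} : Set ℤ) := by simp
  have k1 : SS β a i 1 ∈ TT β a {1, 2} := by
    rw [H.SS1]; have := AA.leTT h1 (AA.memS (β := β) (a := a) 1); rwa [one_smul] at this
  refine ⟨?_, ?_, ?_⟩
  · refine mem_of_comb P.two (add_mem k1 (AA.leTT h1 (add_mem (AA.mem i (2 * β))
      (AA.mem (i + 1) (2 * β))))) ?_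
    unfold SS; module
  · rw [H.SS_sub] at k1
    refine mem_of_comb P.two (add_mem k1 (AA.leTT h1 (add_mem (AA.mem i (2 * β))
      (AA.mem (i - 1) (2 * β))))) ?_
    module
  · have := SS_TT h1 (by simp) hs2 i
    refine mem_of_comb P.two (add_mem this (AA.leTT h1 (add_mem (AA.mem i (2 * β))
      (AA.mem (i + 2) (2 * β))))) ?_
    unfold SS; module

theorem Pre.relC2 {α β l1 l2 : F} {a : ℤ → V} (P : Par α β) (H : Pre α β l1 l2 a) (i : ℤ) :
     (β * (α - β) ^ 2 * (4 * β - α)) • (a (i - 2) + a (i - 1) - a (i + 3) - a (i + 4))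
     + (qm1 α β l1 - β * (α - β) ^ 2 * (4 * β - α)) • (a (i - 1) + a i - a (i + 2) - a (i + 3))
     + (qm0 α β l1 l2 - qm1 α β l1) • (a i - a (i + 2)) = 0 := by
  have c1 := H.relC P i
  have c2 := H.relC P (i + 1)
  have := H.SS_step i 2
  rw [show i + 1 + 1 = i + 2 by ring, show i + 1 - 2 = i - 1 by ring, show i + 1 + 3 = i + 4 by ring,
    show i + 1 - 1 = i by ring, show i + 1 + 2 = i + 3 by ring, this] at c2
  linear_combination (norm := module) c1 + c2

theorem Pre.hs2 {α β l1 l2 : F} {a : ℤ → V} (P : Par α β) (H : Pre α β l1 l2 a) (r : ℤ) :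
    SS β a (r + 1) 2 - SS β a r 2 ∈ AA β a := by
  have hK : 2 * β * (α - β) ^ 2 ≠ 0 :=
    mul_ne_zero (mul_ne_zero P.two P.b0) (pow_ne_zero _ (sub_ne_zero.2 P.ab))
  have c1 := H.relC P r
  refine mem_of_comb hK (add_mem (add_mem (add_mem (AA.mem (r - 2) (β * (α - β) ^ 2 * (4 * β - α)))
    (AA.mem (r + 3) (-(β * (α - β) ^ 2 * (4 * β - α)))))
    (add_mem (AA.mem (r - 1) (qm1 α β l1 - β * (α - β) ^ 2 * (4 * β - α)))
    (AA.mem (r + 2) (-(qm1 α β l1 - β * (α - β) ^ 2 * (4 * β - α))))))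
    (add_mem (AA.mem r (qm0 α β l1 l2 - qm1 α β l1))
    (AA.mem (r + 1) (-(qm0 α β l1 l2 - qm1 α β l1))))) ?_
  linear_combination (norm := module) -c1

theorem Pre.rp_gen {α β l1 l2 : F} {a : ℤ → V} (P : Par α β) (h4 : α ≠ 4 * β)
    (H : Pre α β l1 l2 a) (i : ℤ) : a (i + 4) ∈ Wn F a i := by
  have hK : β * (α - β) ^ 2 * (4 * β - α) ≠ 0 :=
    mul_ne_zero (mul_ne_zero P.b0 (pow_ne_zero _ (sub_ne_zero.2 P.ab))) (sub_ne_zero.2 h4.symm)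
  have c := H.relC2 P i
  set y := β * (α - β) ^ 2 * (4 * β - α)
  set m := qm1 α β l1 - y
  set n := qm0 α β l1 l2 - qm1 α β l1
  refine memWn_of (c := y) (-y - m) (-m-n) 0 (m+n) (y+m) y 0 hK ?_
  linear_combination (norm := module) -c

theorem Pre.projSi {α β l1 l2 : F} {a : ℤ → V} (P : Par α β) (H : Pre α β l1 l2 a) (i : ℤ) :
    HasProj F α β (a i) (SS β a i 2) (2 * (l2 - β - β * l2)) := (H.tri P (H.p2 i)).pS P

theorem Pre.projX {α β l1 l2 : F} {a : ℤ → V} (P : Par α β) (H : Pre α β l1 l2 a) (i : ℤ) :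
    HasProj F α β (a i) (SS β a (i + 1) 2) (2 * (l1 - β - 2 * β * l1 + β * l2)) := by
  have e := H.SS_step' (i + 1) 2
  rw [show i + 1 - 2 = i - 1 by ring] at e
  rw [← e]; exact (H.level1 P i).1

theorem Pre.h3p_gen {α β l1 l2 : F} {a : ℤ → V} (P : Par α β) (h4 : α ≠ 4 * β)
    (H : Pre α β l1 l2 a) (i : ℤ) : ∃ l, HasProj F α β (a i) (a (i + 3)) l := by
  have hK : β * (α - β) ^ 2 * (4 * β - α) ≠ 0 :=
    mul_ne_zero (mul_ne_zero P.b0 (pow_ne_zero _ (sub_ne_zero.2 P.ab))) (sub_ne_zero.2 h4.symm)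
  have c := H.relC P i
  set y := β * (α - β) ^ 2 * (4 * β - α)
  set m := qm1 α β l1 - y
  set n := qm0 α β l1 l2 - qm1 α β l1
  have k := (((((((H.projSi P i).smul (2 * β * (α - β) ^ 2)).sub
    ((H.projX P i).smul (2 * β * (α - β) ^ 2))).add ((H.projneg (H.p2 i)).smul y)).add
    ((H.projneg (H.p1 i)).smul m)).sub ((H.p2 i).smul m)).add
    (HasProj.self.smul n)).sub ((H.p1 i).smul n)
  refine ⟨_, (k.smul y⁻¹).congr ?_ rfl⟩
  have e : y • a (i + 3) = (2 * β * (α - β) ^ 2) • SS β a i 2 - (2 * β * (α - β) ^ 2) • SS β a (i + 1) 2 +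
      y • a (i - 2) + m • a (i - 1) - m • a (i + 2) + n • a i - n • a (i + 1) := by
    linear_combination (norm := module) -c
  rw [← e, smul_smul, inv_mul_cancel₀ hK, one_smul]

theorem Pre.h3_gen {α β l1 l2 : F} {a : ℤ → V} (P : Par α β) (h4 : α ≠ 4 * β) (h2 : α ≠ 2 * β)
    (H : Pre α β l1 l2 a) (i : ℤ) : a i * a (i + 3) ∈ TT β a {1, 2} := by
  have hK : β * (α - β) ^ 2 * (4 * β - α) ≠ 0 :=
    mul_ne_zero (mul_ne_zero P.b0 (pow_ne_zero _ (sub_ne_zero.2 P.ab))) (sub_ne_zero.2 h4.symm)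
  have h1N : (1 : ℤ) ∈ ({1, 2} : Set ℤ) := by simp
  set T := TT β a {1, 2} with hT
  have c := congrArg (a i * ·) (H.relC P i)
  have A := (H.level1 P i).2.1
  have e := H.SS_step' (i + 1) 2
  rw [show i + 1 - 2 = i - 1 by ring] at e
  rw [e] at A
  have am : ∀ j, a j ∈ T := fun j => by
    have := AA.leTT h1N (AA.mem (β := β) (a := a) j 1); rwa [one_smul] at this
  have s1 : SS β a 0 1 ∈ T := by
    have := AA.leTT h1N (AA.memS (β := β) (a := a) 1); rwa [one_smul] at this
  have s2 := SS_TT h1N (N := {1, 2}) (by simp) (H.hs2 P) i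
  obtain ⟨q1, q2, q3⟩ := H.prod12 P (H.hs2 P) i
  have aX : a i * SS β a (i + 1) 2 ∈ T := by
    refine mem_of_comb (c := 2 * β - α) (sub_ne_zero.2 h2.symm) (T.neg_mem (add_mem (add_mem (add_mem (add_mem
      (T.smul_mem (4*β^3-2*α*β^2-2*β^2-8*α*β*l1+4*β*l1+4*α^2*β-α*β) (add_mem (am (i+1)) (am (i-1))))
      (T.smul_mem (2*β^2*(α-β)) (add_mem (am (i+2)) (am (i-2)))))
      (T.smul_mem (4*β^3-16*α*β*l1+8*β*l1-2*α*β*l2+8*α^2*β-4*α*β+16*α*l1^2-8*l1^2-8*α^2*l1+4*α*l1)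
        (am i))) (T.smul_mem (4*β^2-2*α*β-2*β-8*α*l1+4*l1+4*α^2-α) s1)) (T.smul_mem (2*β*(α-β)) s2))) ?_
    linear_combination (norm := module) A
  have aS : a i * SS β a i 2 ∈ T := by
    rw [(H.tri P (H.p2 i)).hS (H.ax i) P]
    exact add_mem (add_mem (T.smul_mem _ s2) (T.smul_mem _ (add_mem (am _) (am _)))) (T.smul_mem _ (am _))
  have q4 : a i * a (i - 2) ∈ T := by
    have := mem_eig.1 (H.anti i 2)
    rw [mul_sub] at this
    convert sub_mem q3 (T.smul_mem β (sub_mem (am (i + 2)) (am (i - 2)))) using 1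
    linear_combination (norm := module) -this
  set y := β * (α - β) ^ 2 * (4 * β - α)
  set m := qm1 α β l1 - y
  set n := qm0 α β l1 l2 - qm1 α β l1
  simp only [mul_add, mul_sub, mul_smul_comm, (H.ax i).idem, mul_zero] at c
  refine mem_of_comb hK (add_mem (add_mem (add_mem (T.smul_mem (2 * β * (α - β) ^ 2) (sub_mem aS aX))
    (T.smul_mem y q4)) (T.smul_mem m (sub_mem q2 q3))) (T.smul_mem n (sub_mem (am i) q1))) ?_
  linear_combination (norm := module) -c

theorem Pre.caseII {α β l1 l2 : F} {a : ℤ → V} (P : Par α β) (h4 : α ≠ 4 * β) (h2 : α ≠ 2 * β)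
    (H : Pre α β l1 l2 a) : Good α β (a 0) (a 1) :=
  H.finish2 P (H.rp_gen P h4) (rm_of_refl (H.refl.rp_gen P h4)) (H.hs2 P) (H.h3_gen P h4 h2)
    (H.h3p_gen P h4)

theorem Pre.caseI {α β l1 l2 : F} {a : ℤ → V} (P : Par α β) (h2 : α = 2 * β)
    (H : Pre α β l1 l2 a) : Good α β (a 0) (a 1) := by
  have h4 : α ≠ 4 * β := by
    intro h
    have : 2 * β = 0 := by linear_combination h2 - h
    exact (mul_ne_zero P.two P.b0) this
  refine H.finish3 P (H.rp_gen P h4) (rm_of_refl (H.refl.rp_gen P h4)) (H.hs2 P) ?_ (H.h3p_gen P h4)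
  have ma := fun j (c : F) => AA.mem (β := β) (a := a) j c
  have ms := fun (c : F) => AA.memS (β := β) (a := a) c
  have hb : 2 * β ^ 2 ≠ 0 := mul_ne_zero P.two (pow_ne_zero _ P.b0)
  have hS2 : ∀ i, SS β a i 2 ∈ AA β a := by
    intro i
    have A := (H.level1 P i).2.1
    rw [h2] at A
    refine mem_of_comb hb (neg_mem (add_mem (add_mem (add_mem (add_mem
      (ma (i + 1) (4*β^3-2*(2*β)*β^2-2*β^2-8*(2*β)*β*l1+4*β*l1+4*(2*β)^2*β-(2*β)*β))
      (ma (i - 1) (4*β^3-2*(2*β)*β^2-2*β^2-8*(2*β)*β*l1+4*β*l1+4*(2*β)^2*β-(2*β)*β)))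
      (add_mem (ma (i + 2) (2*β^2*β)) (ma (i - 2) (2*β^2*β))))
      (ma i (4*β^3-16*(2*β)*β*l1+8*β*l1-2*(2*β)*β*l2+8*(2*β)^2*β-4*(2*β)*β+16*(2*β)*l1^2-8*l1^2-8*(2*β)^2*l1+4*(2*β)*l1)))
      (ms (4*β^2-2*(2*β)*β-2*β-8*(2*β)*l1+4*l1+4*(2*β)^2-(2*β))))) ?_
    linear_combination (norm := module) A
  have p0 : ∀ i, a i ∈ AA β a := fun i => by have := ma i 1; rwa [one_smul] at this
  have p1 : ∀ i, a i * a (i + 1) ∈ AA β a := by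
    intro i
    refine mem_of_comb P.two (add_mem (ms 1) (add_mem (ma i (2 * β)) (ma (i + 1) (2 * β)))) ?_
    rw [← H.SS1 i]; unfold SS; module
  have p1' : ∀ i, a i * a (i - 1) ∈ AA β a := by
    intro i
    refine mem_of_comb P.two (add_mem (ms 1) (add_mem (ma i (2 * β)) (ma (i - 1) (2 * β)))) ?_
    rw [← H.SS1 i, H.SS_sub]; module
  have p2 : ∀ i, a i * a (i + 2) ∈ AA β a := by
    intro i
    refine mem_of_comb P.two (add_mem (hS2 i) (add_mem (ma i (2 * β)) (ma (i + 2) (2 * β)))) ?_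
    unfold SS; module
  have key : ∀ i, (2 : F) • (SS β a 0 1 * SS β a 0 1) - (β ^ 2) • SS β a i 3 ∈ AA β a := by
    intro i
    have B := (H.level1 P i).2.2
    have A := congrArg (a i * ·) ((H.level1 P (i + 1)).2.1)
    have e := H.SS_step' (i + 1) 2
    rw [show i + 1 - 2 = i - 1 by ring] at e
    rw [h2, e] at B
    rw [show i + 1 - 1 = i by ring, show i + 1 + 1 = i + 2 by ring, show i + 1 + 2 = i + 3 by ring,
      show i + 1 - 2 = i - 1 by ring, h2] at A
    have s1 := H.aS1 P i
    have M1 : a i * SS β a 0 1 ∈ AA β a := by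
      rw [s1]
      exact add_mem (add_mem (ms _) (by rw [smul_add]; exact add_mem (ma _ _) (ma _ _))) (ma _ _)
    simp only [mul_add, mul_smul_comm, (H.ax i).idem, mul_zero, sub_self, zero_smul] at A
    have aX : β • (a i * SS β a (i + 1) 2) + (β ^ 2) • (a i * a (i + 3)) ∈ AA β a := by
      refine mem_of_comb (c := 2 * β) (mul_ne_zero P.two P.b0) (neg_mem
        (add_mem (add_mem (add_mem (add_mem
        ((AA β a).smul_mem (4*β^3-2*(2*β)*β^2-2*β^2-8*(2*β)*β*l1+4*β*l1+4*(2*β)^2*β-(2*β)*β) (p2 i))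
        (ma i (4*β^3-2*(2*β)*β^2-2*β^2-8*(2*β)*β*l1+4*β*l1+4*(2*β)^2*β-(2*β)*β)))
        ((AA β a).smul_mem (2*β^2*β) (p1' i)))
        ((AA β a).smul_mem (4*β^3-16*(2*β)*β*l1+8*β*l1-2*(2*β)*β*l2+8*(2*β)^2*β-4*(2*β)*β+16*(2*β)*l1^2-8*l1^2-8*(2*β)^2*l1+4*(2*β)*l1)
          (p1 i)))
        ((AA β a).smul_mem (4*β^2-2*(2*β)*β-2*β-8*(2*β)*l1+4*l1+4*(2*β)^2-(2*β)) M1))) ?_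
      linear_combination (norm := module) A
    have aX2 : (2 * β) • (a i * SS β a (i + 1) 2) + (β ^ 2) • SS β a i 3 ∈ AA β a := by
      convert sub_mem ((AA β a).smul_mem 2 aX) (add_mem (ma i (2*β^3)) (ma (i + 3) (2*β^3))) using 1
      unfold SS; module
    have hB : (2 : F) • (SS β a 0 1 * SS β a 0 1) + (2 * β) • (a i * SS β a (i + 1) 2) ∈ AA β a := by
      refine mem_of_comb (c := 1) one_ne_zero ((AA β a).smul_mem 2
        (add_mem (add_mem (add_mem (add_mem (add_mem ((AA β a).smul_mem (β*β) (hS2 (i + 1)))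
        ((AA β a).smul_mem (β*β) (hS2 i)))
        ((AA β a).smul_mem (4*β^3-8*(2*β)*β^2+2*β^2+2*(2*β)*β*l1-2*β*l1+4*(2*β)^2*β-2*(2*β)*β-2*(2*β)^2*l1+2*(2*β)*l1)
          (add_mem (p0 (i + 1)) (p0 (i - 1)))))
        ((AA β a).smul_mem (β*β^2) (add_mem (p0 (i + 2)) (p0 (i - 2)))))
        (ma i (6*β^3-12*(2*β)*β^2+4*β^2+4*(2*β)*β*l1-4*β*l1+6*(2*β)^2*β-4*(2*β)*β-4*(2*β)^2*l1+4*(2*β)*l1)))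
        (ms (6*β^2-10*(2*β)*β-β-2*(2*β)*l1+2*l1+4*(2*β)^2-(2*β))))) ?_
      linear_combination (norm := module) (-2 : F) • B
    convert sub_mem hB aX2 using 1; module
  intro r
  refine mem_of_comb (c := β ^ 2) (pow_ne_zero _ P.b0) (sub_mem (key r) (key (r + 1))) ?_
  module

/-- a four-term recurrence suffices -/
theorem Pre.short {α β l1 l2 : F} {a : ℤ → V} (P : Par α β) (H : Pre α β l1 l2 a)
    (r : ∀ a : ℤ → V, Pre α β l1 l2 a → ∀ i, ∃ c1 c2 c3 c4 : F,
      a (i + 3) = c1 • a (i - 1) + c2 • a i + c3 • a (i + 1) + c4 • a (i + 2)) :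
    Good α β (a 0) (a 1) := by
  have rp : ∀ a : ℤ → V, Pre α β l1 l2 a → ∀ i, a (i + 4) ∈ Wn F a i := by
    intro a H i
    obtain ⟨c1, c2, c3, c4, e⟩ := r a H (i + 1)
    rw [show i + 1 - 1 = i by ring, show i + 1 + 1 = i + 2 by ring, show i + 1 + 2 = i + 3 by ring,
      show i + 1 + 3 = i + 4 by ring] at e
    refine memWn_of (c := 1) c4 c3 c2 c1 0 0 0 one_ne_zero ?_
    linear_combination (norm := module) e
  refine H.finish2 P (rp a H) (rm_of_refl (rp _ H.refl)) (H.hs2 P) ?_ ?_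
  · intro i
    obtain ⟨c1, c2, c3, c4, e⟩ := r a H i
    obtain ⟨q1, q2, q3⟩ := H.prod12 P (H.hs2 P) i
    rw [e]
    simp only [mul_add, mul_smul_comm, (H.ax i).idem]
    exact add_mem (add_mem (add_mem (Submodule.smul_mem _ _ q2) (AA.leTT (by simp) (AA.mem i c2)))
      (Submodule.smul_mem _ _ q1)) (Submodule.smul_mem _ _ q3)
  · intro i
    obtain ⟨c1, c2, c3, c4, e⟩ := r a H i
    rw [e]
    exact ⟨_, ((((H.projneg (H.p1 i)).smul c1).add (HasProj.self.smul c2)).add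
      ((H.p1 i).smul c3)).add ((H.p2 i).smul c4)⟩

theorem eq_of_smul {x y : V} {c : F} (hc : c ≠ 0) (h : c • x = y) : x = c⁻¹ • y := by
  rw [← h, smul_smul, inv_mul_cancel₀ hc, one_smul]

theorem Pre.caseIIIa {α β l1 l2 : F} {a : ℤ → V} (P : Par α β) (h4 : α = 4 * β)
    (hm : qm1 α β l1 ≠ 0) (H : Pre α β l1 l2 a) : Good α β (a 0) (a 1) := by
  refine H.short P ?_
  intro a H i
  have c := H.relC2 P i
  have z : β * (α - β) ^ 2 * (4 * β - α) = 0 := by rw [h4]; ring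
  rw [z] at c
  set m := qm1 α β l1
  set n := qm0 α β l1 l2 - m
  have e : m • a (i + 3) = m • a (i - 1) + (m + n) • a i - (m + n) • a (i + 2) := by
    linear_combination (norm := module) -c
  refine ⟨m⁻¹ * m, m⁻¹ * (m + n), 0, -(m⁻¹ * (m + n)), ?_⟩
  rw [eq_of_smul hm e]; module

theorem Pre.caseIIIb {α β l1 l2 : F} {a : ℤ → V} (P : Par α β) (h4 : α = 4 * β)
    (hm : qm1 α β l1 = 0) (hn : qm0 α β l1 l2 ≠ 0) (H : Pre α β l1 l2 a) :
    Good α β (a 0) (a 1) := by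
  refine H.short P ?_
  intro a H i
  have c := H.relC2 P (i + 1)
  have z : β * (α - β) ^ 2 * (4 * β - α) = 0 := by rw [h4]; ring
  rw [z, hm, show i + 1 + 2 = i + 3 by ring] at c
  have : (qm0 α β l1 l2) • (a (i + 1) - a (i + 3)) = 0 := by
    linear_combination (norm := module) c
  have := (smul_eq_zero.1 this).resolve_left hn
  refine ⟨0, 0, 1, 0, ?_⟩
  linear_combination (norm := module) -this

/-- in the remaining case all `S_{r,2}` agree -/
theorem Pre.S2const {α β l1 l2 : F} {a : ℤ → V} (P : Par α β) (h4 : α = 4 * β)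
    (hm : qm1 α β l1 = 0) (hn : qm0 α β l1 l2 = 0) (H : Pre α β l1 l2 a) (r : ℤ) :
    SS β a r 2 = SS β a 0 2 := by
  have st : ∀ r, SS β a (r + 1) 2 = SS β a r 2 := by
    intro r
    have hK : 2 * β * (α - β) ^ 2 ≠ 0 :=
      mul_ne_zero (mul_ne_zero P.two P.b0) (pow_ne_zero _ (sub_ne_zero.2 P.ab))
    have c := H.relC P r
    have z : β * (α - β) ^ 2 * (4 * β - α) = 0 := by rw [h4]; ring
    rw [z, hm, hn] at c
    have : (2 * β * (α - β) ^ 2) • (SS β a r 2 - SS β a (r + 1) 2) = 0 := by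
      linear_combination (norm := module) c
    exact (sub_eq_zero.1 ((smul_eq_zero.1 this).resolve_left hK)).symm
  induction r using Int.induction_on with
  | zero => rfl
  | succ i ih => rw [st, ih]
  | pred i ih => rw [← ih, ← st (-i - 1)]; congr 1; ring

theorem Pre.caseIIIc {α β l1 l2 : F} {a : ℤ → V} (P : Par α β) (h4 : α = 4 * β)
    (hm : qm1 α β l1 = 0) (hn : qm0 α β l1 l2 = 0)
    (hp : 4*β^3-2*α*β^2-2*β^2-8*α*β*l1+4*β*l1+4*α^2*β-α*β ≠ 0) (H : Pre α β l1 l2 a) :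
    Good α β (a 0) (a 1) := by
  refine H.short P ?_
  intro a H i
  set p := 4*β^3-2*α*β^2-2*β^2-8*α*β*l1+4*β*l1+4*α^2*β-α*β with hpd
  obtain ⟨q, r, hq⟩ : ∃ q r : F, ∀ i, p • (a (i + 1) + a (i - 1)) + q • SS β a 0 1 + r • a i = 0 := by
    refine ⟨4*β^2-2*α*β-2*β-8*α*l1+4*l1+4*α^2-α, (4*β^3-16*α*β*l1+8*β*l1-2*α*β*l2+8*α^2*β-4*α*β+16*α*l1^2-8*l1^2-8*α^2*l1+4*α*l1) + (2 * β - α) * (2 * dd α β l2), fun i => ?_⟩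
    · have A := (H.level1 P i).2.1
      have e := (H.tri P (H.p2 i)).hS (H.ax i) P
      rw [H.S2const P h4 hm hn (i - 1), H.S2const P h4 hm hn i, ← hpd] at A
      rw [H.S2const P h4 hm hn i] at e
      rw [e] at A
      set q := 4*β^2-2*α*β-2*β-8*α*l1+4*l1+4*α^2-α with hq
      set r := 4*β^3-16*α*β*l1+8*β*l1-2*α*β*l2+8*α^2*β-4*α*β+16*α*l1^2-8*l1^2-8*α^2*l1+4*α*l1 with hr
      have k : p • (a (i + 1) + a (i - 1)) + q • SS β a 0 1
        + (r + (2 * β - α) * (2 * dd α β l2)) • a i = 0 := by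
        clear_value p q r
        subst h4
        linear_combination (norm := module) A
      exact k
  have k1 := hq (i + 1)
  have k2 := hq (i + 2)
  rw [show i + 1 + 1 = i + 2 by ring, show i + 1 - 1 = i by ring] at k1
  rw [show i + 2 + 1 = i + 3 by ring, show i + 2 - 1 = i + 1 by ring] at k2
  have e : p • a (i + 3) = p • a i + (r - p) • a (i + 1) + (p - r) • a (i + 2) := by
    linear_combination (norm := module) k2 - k1
  refine ⟨0, p⁻¹ * p, p⁻¹ * (r - p), p⁻¹ * (p - r), ?_⟩
  rw [eq_of_smul hp e]; module

theorem three_ne {α β : F} (P : Par α β) (h4 : α = 4 * β) : (3 : F) ≠ 0 := by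
  intro h
  exact P.ab (by linear_combination h4 + β * h)

/-- what is left -/
theorem Pre.trich {α β l1 l2 : F} {a : ℤ → V} (P : Par α β) (H : Pre α β l1 l2 a) :
    Good α β (a 0) (a 1) ∨ (α = 4 * β ∧ qm1 α β l1 = 0 ∧ qm0 α β l1 l2 = 0 ∧
      ((12 * β = 1 ∧ 16 * l1 = 1 ∧ 16 * l2 = 1) ∨ (2 * β = 1 ∧ l1 = 1 ∧ l2 = 1))) := by
  by_cases h2 : α = 2 * β
  · exact Or.inl (H.caseI P h2)
  by_cases h4 : α = 4 * β
  swap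
  · exact Or.inl (H.caseII P h4 h2)
  by_cases hm : qm1 α β l1 = 0
  swap
  · exact Or.inl (H.caseIIIa P h4 hm)
  by_cases hn : qm0 α β l1 l2 = 0
  swap
  · exact Or.inl (H.caseIIIb P h4 hm hn)
  by_cases hp : 4*β^3-2*α*β^2-2*β^2-8*α*β*l1+4*β*l1+4*α^2*β-α*β = 0
  swap
  · exact Or.inl (H.caseIIIc P h4 hm hn hp)
  right
  have h3 := three_ne P h4
  have b0 := P.b0
  have t0 := P.two
  refine ⟨h4, hm, hn, ?_⟩
  have e1 : 8 * l1 = 18 * β - 1 := by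
    have : (2 * 3 * β ^ 3) * (8 * l1 - (18 * β - 1)) = 0 := by
      have := hm; unfold qm1 at this; rw [h4] at this; linear_combination -this
    have h : (2 * 3 * β ^ 3) ≠ 0 := mul_ne_zero (mul_ne_zero t0 h3) (pow_ne_zero _ b0)
    exact sub_eq_zero.1 ((mul_eq_zero.1 this).resolve_left h)
  have e2 : (12 * β - 1) * (2 * β - 1) = 0 := by
    have : β * ((12 * β - 1) * (2 * β - 1)) = 0 := by
      rw [h4] at hp; linear_combination -2 * hp + (-8 * β ^ 2 + β) * e1
    exact (mul_eq_zero.1 this).resolve_left b0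
  have h := hn
  unfold qm0 at h
  rw [h4] at h
  rcases mul_eq_zero.1 e2 with hb | hb
  · left
    have hb' : 12 * β = 1 := by linear_combination hb
    have hl1 : 16 * l1 = 1 := by linear_combination 2 * e1 + 3 * hb'
    refine ⟨hb', hl1, ?_⟩
    clear hm hn hp e1 e2 hb
    have : (2 * β) * (β * (16 * l2 - 1)) = 0 := by grind
    have := (mul_eq_zero.1 ((mul_eq_zero.1 this).resolve_left (mul_ne_zero t0 b0))).resolve_left b0
    linear_combination this
  · right
    have hb' : 2 * β = 1 := by linear_combination hb
    have hl1 : l1 = 1 := by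
      have : (8 : F) * (l1 - 1) = 0 := by linear_combination e1 + 9 * hb'
      have h8 : (8 : F) ≠ 0 := by
        rw [show (8 : F) = 2 ^ 3 by norm_num]; exact pow_ne_zero _ t0
      exact sub_eq_zero.1 ((mul_eq_zero.1 this).resolve_left h8)
    refine ⟨hb', hl1, ?_⟩
    clear hm hn hp e1 e2 hb
    subst hl1
    have : 3 * (l2 - 1) = 0 := by grind
    exact sub_eq_zero.1 ((mul_eq_zero.1 this).resolve_left h3)

def rA1 (α β l : F) : F := 3*α*β^2-2*β^2-4*α*β*l+2*β*l+α^2*β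
def rA2 (α β l : F) : F := 4*β^3-2*α*β^2-2*β^2-4*α*β*l+2*β*l+2*α^2*β
def rA0 (α β l l3 : F) : F := 4*β^3+6*α*β^2-4*β^2-22*α*β*l+12*β*l-2*α*β*l3+6*α^2*β-2*α*β+16*α*l^2-8*l^2-6*α^2*l+2*α*l
def rB1 (α β l : F) : F := 4*β^3-8*α*β^2+2*β^2+2*α*β*l-2*β*l+4*α^2*β-2*α*β-2*α^2*l+2*α*l
def rB0 (α β l : F) : F := 2*β^3-4*α*β^2+2*β^2+2*α*β*l-2*β*l+2*α^2*β-2*α*β-2*α^2*l+2*α*l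

theorem lev3 {α β l l3 : F} (P : Par α β) {a M1 M2 M3 S1 S2 S3 Z : V} (h : PAx α β a)
    (T1 : Tri α β l a M1 S1) (T2 : Tri α β l a M2 S2) (T3 : Tri α β l3 a M3 S3)
    (hMM : M1 * M2 = S1 + Z + (2 * β) • (M1 + M2))
    (hS1M2 : S1 * M2 = (2 * (α - β)) • S1 + (β * (α - β)) • (M1 + M3) + (2 * dd α β l) • M2)
    (hS2M1 : S2 * M1 = (2 * (α - β)) • S2 + (β * (α - β)) • (M1 + M3) + (2 * dd α β l) • M1) :
    HasProj F α β a Z (2 * (l - 2 * β * l + β * l3 - β)) ∧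
    (2 * β - α) • (a * Z) + rA1 α β l • M1 + rA2 α β l • M2
      + (2*β^2*(α-β)) • M3 + rA0 α β l l3 • a
      + (3*α*β-2*β-4*α*l+2*l+α^2) • S1 + (4*β^2-2*α*β-2*β-4*α*l+2*l+2*α^2) • S2
      + (2*β*(α-β)) • S3 = 0 ∧
    -(S1 * S2) + (β - α) • (a * Z) + (β*(α-β)) • Z + (β*(α-β)) • S3
      + rB1 α β l • M1
      + (β*(α-β)^2) • M3 + rB0 α β l • a
      + (3*β^2-4*α*β+α^2) • S1 + (2*β^2-4*α*β-2*β-2*α*l+2*l+2*α^2) • S2 = 0 := by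
  have m1 := T1.hM h P
  have s1 := T1.hS h P
  have m2 := T2.hM h P
  have s2 := T2.hS h P
  have m3 := T3.hM h P
  have pm1 := T1.pM P
  have ps1 := T1.pS P
  have pm2 := T2.pM P
  have pm3 := T3.pM P
  have ps2 := T2.pS P
  obtain ⟨b1, b2⟩ := lemB P h T1.u0 T2.u0 T2.va Tri.sum
  have hma : M1 * a = S1 + (2 * β) • a + β • M1 := by rw [mul_comm]; exact m1
  have hsa : S1 * a = (α - β) • S1 + (β * (α - β)) • M1 + (2 * dd α β l) • a := by
    rw [mul_comm]; exact s1
  have hMS : M1 * S2 = (2 * (α - β)) • S2 + (β * (α - β)) • (M1 + M3) + (2 * dd α β l) • M1 := by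
    rw [mul_comm]; exact hS2M1
  have hMM' : M2 * M1 = S1 + Z + (2 * β) • (M1 + M2) := by rw [mul_comm]; exact hMM
  have pZ : HasProj F α β a Z (2 * (l - 2 * β * l + β * l3 - β)) := by
    refine HasProj.div (sub_ne_zero.2 P.ab) ?_
    simp only [add_mul, sub_mul, smul_mul_assoc, hMM, hS1M2, m2] at b2
    refine ((((((b2.sub (pm1.smul (2*β*(α-β)-β*(α-β)))).sub
      (pm2.smul (2*β*(α-β)-2*dd α β l+2*β*cc α β l))).sub
      (ps1.smul ((α-β)-2*(α-β)))).sub (ps2.smul (2*cc α β l))).add (pm3.smul (β*(α-β)))).sub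
      (HasProj.self.smul (4*β*cc α β l))).congr ?_ ?_
    · module
    · unfold dd cc; ring
  refine ⟨pZ, ?_, ?_⟩
  · have pv : HasProj F α β a ((S1 + β • M1 + (2 * (β - l)) • a) * M2)
      ((2*(α-β)+β) * (2 * (l - β - β * l)) + (β*(α-β)+2*β^2)*(2*l) + β*(α-β)*(2*l3)
        + (2*dd α β l+2*β^2+2*(β-l)*β)*(2*l) + β*(2 * (l - 2 * β * l + β * l3 - β))
        + 2*(β-l)*(2 * (l - β - β * l)) + 4*(β-l)*β) := by
      simp only [add_mul, sub_mul, smul_mul_assoc, hMM, hS1M2, m2]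
      refine ((((((((ps1.smul (2*(α-β)+β)).add (pm1.smul (β*(α-β)+2*β^2))).add
        (pm3.smul (β*(α-β)))).add
        (pm2.smul (2*dd α β l+2*β^2+2*(β-l)*β))).add (pZ.smul β)).add (ps2.smul (2*(β-l)))).add
        (HasProj.self.smul (4*(β-l)*β)))).congr ?_ ?_
      · module
      · ring
    have A := lemA P h T1.u0 T1.va T2.u0 T2.va Tri.sum Tri.sum pv
    simp only [add_mul, sub_mul, smul_mul_assoc, hMM, hMM', hS1M2, hS2M1, m1, mul_add, mul_sub, mul_smul_comm,
      m2, m3, s1, s2, h.idem] at A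
    unfold dd cc at A
    unfold rA0 rA1 rA2
    linear_combination (norm := module) A
  · simp only [add_mul, sub_mul, smul_mul_assoc, hMM, hMM', hS1M2, hS2M1, hMS, hma, hsa, m1, mul_add, mul_sub, mul_smul_comm,
      m2, m3, s1, s2, h.idem] at b1
    unfold dd cc at b1
    unfold rB1 rB0
    linear_combination (norm := module) b1

theorem Pre.level3 {α β l l3 : F} {a : ℤ → V} (P : Par α β) (H : Pre α β l l a)
    (hc : ∀ r, SS β a r 2 = SS β a 0 2) (i : ℤ) (hl3 : HasProj F α β (a i) (a (i + 3)) l3) :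
    ∃ Z, (2 : F) • Z = SS β a (i + 1) 3 + SS β a (i - 1) 3 ∧
    HasProj F α β (a i) Z (2 * (l - 2 * β * l + β * l3 - β)) ∧
    (2 * β - α) • (a i * Z) + rA1 α β l • (a (i + 1) + a (i - 1)) + rA2 α β l • (a (i + 2) + a (i - 2))
      + (2*β^2*(α-β)) • (a (i + 3) + a (i - 3)) + rA0 α β l l3 • a i
      + (3*α*β-2*β-4*α*l+2*l+α^2) • SS β a 0 1 + (4*β^2-2*α*β-2*β-4*α*l+2*l+2*α^2) • SS β a 0 2
      + (2*β*(α-β)) • SS β a i 3 = 0 ∧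
    -(SS β a 0 1 * SS β a 0 2) + (β - α) • (a i * Z) + (β*(α-β)) • Z + (β*(α-β)) • SS β a i 3
      + rB1 α β l • (a (i + 1) + a (i - 1))
      + (β*(α-β)^2) • (a (i + 3) + a (i - 3)) + rB0 α β l • a i
      + (3*β^2-4*α*β+α^2) • SS β a 0 1 + (2*β^2-4*α*β-2*β-2*α*l+2*l+2*α^2) • SS β a 0 2 = 0 := by
  refine ⟨a (i + 1) * a (i - 2) + a (i - 1) * a (i + 2)
    - β • (a (i + 1) + a (i - 2) + a (i - 1) + a (i + 2)), ?_, ?_⟩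
  · rw [H.SS_sub (i + 1) 3, SS, show i + 1 - 3 = i - 2 by ring, show i - 1 + 3 = i + 2 by ring]
    module
  have T2 := H.tri P (H.p2 i)
  rw [hc i] at T2
  refine lev3 P (H.ax i) (H.tri1 P i) T2 (H.tri P hl3) ?_ ?_ ?_
  · have e1 := H.SS1 (i + 1)
    have e2 := H.SS1 (i - 1)
    rw [H.SS_sub (i - 1) 1] at e2
    unfold SS at e1
    rw [show i + 1 + 1 = i + 2 by ring] at e1
    rw [show i - 1 - 1 = i - 2 by ring] at e2
    have : (2 : F) • ((a (i + 1) + a (i - 1)) * (a (i + 2) + a (i - 2)) - (SS β a 0 1 + (a (i + 1) * a (i - 2) + a (i - 1) * a (i + 2)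
        - β • (a (i + 1) + a (i - 2) + a (i - 1) + a (i + 2)))
      + (2 * β) • (a (i + 1) + a (i - 1) + (a (i + 2) + a (i - 2))))) = 0 := by
      simp only [mul_add, add_mul]
      unfold SS at *
      linear_combination (norm := module) e1 + e2
    exact sub_eq_zero.1 ((smul_eq_zero.1 this).resolve_left P.two)
  · have e1 := H.aS1 P (i + 2)
    have e2 := H.aS1 P (i - 2)
    rw [show i + 2 + 1 = i + 3 by ring, show i + 2 - 1 = i + 1 by ring] at e1
    rw [show i - 2 + 1 = i - 1 by ring, show i - 2 - 1 = i - 3 by ring] at e2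
    rw [mul_comm, add_mul, e1, e2]
    module
  · have e1 := (H.tri P (H.p2 (i + 1))).hS (H.ax _) P
    have e2 := (H.tri P (H.p2 (i - 1))).hS (H.ax _) P
    rw [hc, show i + 1 + 2 = i + 3 by ring, show i + 1 - 2 = i - 1 by ring] at e1
    rw [hc, show i - 1 + 2 = i + 1 by ring, show i - 1 - 2 = i - 3 by ring] at e2
    rw [mul_comm, add_mul, e1, e2]
    module

def gD (α β l : F) : F := 2*((2*β-α)*rB1 α β l+(α-β)*rA1 α β l)
def gE (α β l l3 : F) : F := 2*((2*β-α)*rB0 α β l+(α-β)*rA0 α β l l3)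

theorem Pre.relD {α β l l3 l3' : F} {a : ℤ → V} (P : Par α β) (H : Pre α β l l a)
    (hc : ∀ r, SS β a r 2 = SS β a 0 2) (i : ℤ) (hl3 : HasProj F α β (a i) (a (i + 3)) l3)
    (hl3' : HasProj F α β (a (i + 1)) (a (i + 4)) l3') :
    (β * (α - β) * (3 * α - 2 * β)) • (SS β a i 3 - SS β a (i + 1) 3)
     + (2 * (α - β) * rA2 α β l) • (a (i - 2) - a (i + 3) - a (i - 1) + a (i + 2))
     + gD α β l • (a (i - 1) - a (i + 2) - a i + a (i + 1))
     + gE α β l l3 • a i - gE α β l l3' • a (i + 1)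
     + (2 * β * (α - β) ^ 2 * (4 * β - α)) • (a (i + 3) + a (i - 3) - a (i + 4) - a (i - 2)) = 0 := by
  obtain ⟨Z, hZ, -, A, B⟩ := H.level3 P hc i hl3
  rw [show i + 4 = i + 1 + 3 by ring] at hl3'
  obtain ⟨Z', hZ', -, A', B'⟩ := H.level3 P hc (i + 1) hl3'
  have e := H.SS_step (i - 1) 3
  rw [show i - 1 + 3 = i + 2 by ring] at e
  rw [show i + 1 - 1 = i by ring, show i + 1 + 1 = i + 2 by ring, e] at hZ'
  rw [show i + 1 - 1 = i by ring, show i + 1 + 1 = i + 2 by ring, show i + 1 + 2 = i + 3 by ring,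
    show i + 1 - 2 = i - 1 by ring, show i + 1 - 3 = i - 2 by ring,
    show i + 1 + 3 = i + 4 by ring] at A'
  rw [show i + 1 - 1 = i by ring, show i + 1 + 1 = i + 2 by ring,
    show i + 1 - 3 = i - 2 by ring, show i + 1 + 3 = i + 4 by ring] at B'
  unfold gE gD
  linear_combination (norm := module) (2 * (2 * β - α)) • (B - B') + (2 * (α - β)) • (A - A')
    - ((2 * β - α) * β * (α - β)) • (hZ - hZ')

theorem Pre.relD12 {α β l l3 l3' : F} {a : ℤ → V} (P : Par α β) (H : Pre α β l l a)
    (h4 : α = 4 * β) (hb : 12 * β = 1) (hl : 16 * l = 1)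
    (hc : ∀ r, SS β a r 2 = SS β a 0 2) (i : ℤ) (hl3 : HasProj F α β (a i) (a (i + 3)) l3)
    (hl3' : HasProj F α β (a (i + 1)) (a (i + 4)) l3') :
    (30 : F) • (SS β a (i + 1) 3 - SS β a i 3) + (5 : F) • (a (i + 3) - a (i - 2))
     + (48 * l3 - 3) • a i - (48 * l3' - 3) • a (i + 1) = 0 := by
  have D := H.relD P hc i hl3 hl3'
  have c1 : 1728 * (β * (α - β) * (3 * α - 2 * β)) = 30 := by rw [h4]; grind
  have c2 : 1728 * (2 * (α - β) * rA2 α β l) = 5 := by rw [h4]; unfold rA2; grind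
  have c3 : 1728 * gD α β l = 5 := by rw [h4]; unfold gD rA1 rB1; grind
  have c4 : ∀ l3, 1728 * gE α β l l3 = 8 - 48 * l3 := by
    intro l3; rw [h4]; unfold gE rA0 rB0; grind
  have c5 : 1728 * (2 * β * (α - β) ^ 2 * (4 * β - α)) = 0 := by rw [h4]; ring
  have D' := congrArg ((1728 : F) • ·) D
  simp only [smul_add, smul_sub, smul_smul, c1, c2, c3, c4, c5] at D'
  linear_combination (norm := module) -D'

theorem Pre.relD2 {α β l l3 l3' : F} {a : ℤ → V} (P : Par α β) (H : Pre α β l l a)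
    (h4 : α = 4 * β) (hb : 2 * β = 1) (hl : l = 1)
    (hc : ∀ r, SS β a r 2 = SS β a 0 2) (i : ℤ) (hl3 : HasProj F α β (a i) (a (i + 3)) l3)
    (hl3' : HasProj F α β (a (i + 1)) (a (i + 4)) l3') :
    (5 : F) • (SS β a (i + 1) 3 - SS β a i 3) + (8 * (l3 - 1)) • a i - (8 * (l3' - 1)) • a (i + 1) = 0 := by
  have D := H.relD P hc i hl3 hl3'
  have h3 := three_ne P h4
  have c1 : 4 * (β * (α - β) * (3 * α - 2 * β)) = 3 * 5 := by rw [h4]; grind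
  have c2 : 4 * (2 * (α - β) * rA2 α β l) = 0 := by rw [h4]; unfold rA2; grind
  have c3 : 4 * gD α β l = 0 := by rw [h4]; unfold gD rA1 rB1; grind
  have c4 : ∀ l3, 4 * gE α β l l3 = 3 * (8 * (1 - l3)) := by
    intro l3; rw [h4]; unfold gE rA0 rB0; grind
  have c5 : 4 * (2 * β * (α - β) ^ 2 * (4 * β - α)) = 0 := by rw [h4]; ring
  have D' := congrArg ((4 : F) • ·) D
  simp only [smul_add, smul_sub, smul_smul, c1, c2, c3, c4, c5] at D'
  have : (3 : F) • ((5 : F) • (SS β a (i + 1) 3 - SS β a i 3) + (8 * (l3 - 1)) • a i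
    - (8 * (l3' - 1)) • a (i + 1)) = 0 := by
    linear_combination (norm := module) -D'
  exact (smul_eq_zero.1 this).resolve_left h3

theorem HasProj.zero_smul {α β : F} (P : Par α β) {a : V} {m : F} (ha : a * a = a)
    (h : HasProj F α β a 0 m) : m • a = 0 := (h.one_eq P (Submodule.zero_mem _) ha).symm

theorem HasProj.unique {α β : F} (P : Par α β) {a x : V} {l m : F} (ha : a * a = a) (ha0 : a ≠ 0)
    (h : HasProj F α β a x l) (h' : HasProj F α β a x m) : l = m := by
  have := HasProj.zero_smul P ha ((h.sub h').congr (sub_self x) rfl)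
  exact sub_eq_zero.1 ((smul_eq_zero.1 this).resolve_right ha0)

theorem Pre.l3eq {α β l l3 l3' : F} {a : ℤ → V} (P : Par α β) (H : Pre α β l l a)
    (h4 : α = 4 * β) (hb : 12 * β = 1) (hl : 16 * l = 1)
    (hc : ∀ r, SS β a r 2 = SS β a 0 2) (h0 : HasProj F α β (a 0) (a 3) l3)
    (h1 : HasProj F α β (a 1) (a 4) l3') (h2 : HasProj F α β (a (-1)) (a 2) l3') (ha : a 0 ≠ 0) :
    l3 = l3' := by
  have D := H.relD12 P h4 hb hl hc 0 (l3 := l3) (l3' := l3') h0 h1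
  have D' := H.relD12 P h4 hb hl hc (-1) (l3 := l3') (l3' := l3) h2 h0
  obtain ⟨Z, hZ, pZ, -⟩ := H.level3 P hc 0 (l3 := l3) h0
  have p3 := (H.tri P (i := 0) (n := 3) (l := l3) h0).pS P
  have pm3 := (H.tri P (i := 0) (n := 3) (l := l3) h0).pM P
  have pm2 := (H.tri P (H.p2 0)).pM P
  have pm1 := (H.tri P (H.p1 0)).pM P
  norm_num at D D' hZ p3 pm3 pm2 pm1
  have k := (((((pZ.smul 60).sub (p3.smul 60)).add (pm3.smul 5)).sub (pm2.smul 5)).add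
    (HasProj.self.smul (96 * l3 - 6))).sub (pm1.smul (48 * l3' - 3))
  have k' : HasProj F α β (a 0) 0 (6 * (l3 - l3')) := by
    refine k.congr ?_ ?_
    · linear_combination (norm := module) (30 : F) • hZ + D - D'
    · grind
  have := HasProj.zero_smul P (H.ax 0).idem k'
  have h6 : (6 : F) ≠ 0 := by
    intro h; apply one_ne_zero (α := F); rw [← hb]; linear_combination 2 * β * h
  have := (mul_eq_zero.1 ((smul_eq_zero.1 this).resolve_right ha)).resolve_left h6
  exact sub_eq_zero.1 this

theorem Pre.rp12 {α β l l3 : F} {a : ℤ → V} (P : Par α β) (H : Pre α β l l a)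
    (h4 : α = 4 * β) (hb : 12 * β = 1) (hl : 16 * l = 1) (h5 : (5 : F) ≠ 0)
    (hm : qm1 α β l = 0) (hn : qm0 α β l l = 0)
    (h3 : ∀ i, HasProj F α β (a i) (a (i + 3)) l3) (j : ℤ) : a (j + 4) ∈ Wn F a j := by
  have hc := H.S2const P h4 hm hn
  have D := fun i => H.relD12 P h4 hb hl hc i (h3 i)
    (by have := h3 (i + 1); rwa [show i + 1 + 3 = i + 4 by ring] at this)
  have D1 := D (j - 1)
  have D2 := D j
  have D3 := D (j + 1)
  have e := H.SS_step (j - 1) 3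
  rw [show j - 1 + 3 = j + 2 by ring] at e
  rw [show j + 1 + 1 = j + 2 by ring, show j + 1 + 3 = j + 4 by ring,
    show j + 1 - 2 = j - 1 by ring, e] at D3
  rw [show j - 1 + 1 = j by ring, show j - 1 + 3 = j + 2 by ring,
    show j - 1 - 2 = j - 3 by ring] at D1
  refine memWn_of (c := 5) (-5) (-5 + (48 * l3 - 3)) 0 0 (5 - (48 * l3 - 3)) 5 5 h5 ?_
  linear_combination (norm := module) D1 + D2 + D3

theorem Pre.case12 {α β l l3 : F} {a : ℤ → V} (P : Par α β) (H : Pre α β l l a)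
    (h4 : α = 4 * β) (hb : 12 * β = 1) (hl : 16 * l = 1) (h5 : (5 : F) ≠ 0)
    (hm : qm1 α β l = 0) (hn : qm0 α β l l = 0)
    (h3 : ∀ i, HasProj F α β (a i) (a (i + 3)) l3) : Good α β (a 0) (a 1) := by
  have h6 : (6 : F) ≠ 0 := by
    intro h; apply one_ne_zero (α := F); rw [← hb]; linear_combination 2 * β * h
  have h30 : (30 : F) ≠ 0 := by
    rw [show (30 : F) = 6 * 5 by norm_num]; exact mul_ne_zero h6 h5
  have hc := H.S2const P h4 hm hn
  refine H.finish3 P (H.rp12 P h4 hb hl h5 hm hn h3) (rm_of_refl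
    (H.refl.rp12 (l3 := l3) P h4 hb hl h5 hm hn ?_)) (H.hs2 P) ?_ (fun i => ⟨l3, h3 i⟩)
  · intro i
    have := H.projneg (h3 (-i))
    rwa [show -i - 3 = -(i + 3) by ring] at this
  · intro i
    have D := H.relD12 P h4 hb hl hc i (h3 i)
      (by have := h3 (i + 1); rwa [show i + 1 + 3 = i + 4 by ring] at this)
    refine mem_of_comb h30 (add_mem (add_mem (AA.mem (i + 3) (-5)) (AA.mem (i - 2) 5))
      (add_mem (AA.mem i (-(48 * l3 - 3))) (AA.mem (i + 1) (48 * l3 - 3)))) ?_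
    linear_combination (norm := module) D

theorem eig_map {g : V ≃ₗ[F] V} (hg : ∀ x y, g (x * y) = g x * g y) {a w : V} {μ : F}
    (h : w ∈ eigSp F a μ) : g w ∈ eigSp F (g a) μ := by
  rw [mem_eig] at *; rw [← hg, h, map_smul]

theorem eig_symm {g : V ≃ₗ[F] V} (hg : ∀ x y, g (x * y) = g x * g y) {a w : V} {μ : F}
    (h : w ∈ eigSp F (g a) μ) : ∃ w', w' ∈ eigSp F a μ ∧ g w' = w := by
  refine ⟨g.symm w, ?_, by simp⟩
  rw [mem_eig] at *; apply g.injective; rw [hg, map_smul]; simpa using h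

theorem HasProj.map {g : V ≃ₗ[F] V} (hg : ∀ x y, g (x * y) = g x * g y) {α β : F} {a x : V} {l : F}
    (h : HasProj F α β a x l) : HasProj F α β (g a) (g x) l := by
  obtain ⟨v0, h0, v1, h1, v2, h2, rfl⟩ := h
  exact ⟨g v0, eig_map hg h0, g v1, eig_map hg h1, g v2, eig_map hg h2, by simp⟩

theorem PAx.map {g : V ≃ₗ[F] V} (hg : ∀ x y, g (x * y) = g x * g y) {α β : F} {a : V}
    (h : PAx α β a) : PAx α β (g a) where
  idem := by rw [← hg, h.idem]
  f00 u hu w hw := by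
    obtain ⟨u, hu', rfl⟩ := eig_symm hg hu
    obtain ⟨w, hw', rfl⟩ := eig_symm hg hw
    rw [← hg]; exact eig_map hg (h.f00 u hu' w hw')
  f0a u hu w hw := by
    obtain ⟨u, hu', rfl⟩ := eig_symm hg hu
    obtain ⟨w, hw', rfl⟩ := eig_symm hg hw
    rw [← hg]; exact eig_map hg (h.f0a u hu' w hw')
  faa u hu w hw := by
    obtain ⟨u, hu', rfl⟩ := eig_symm hg hu
    obtain ⟨w, hw', rfl⟩ := eig_symm hg hw
    rw [← hg]
    obtain ⟨p, hp, q, hq, e⟩ := Submodule.mem_sup.1 (h.faa u hu' w hw')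
    rw [← e, map_add]
    exact Submodule.add_mem_sup (eig_map hg hp) (eig_map hg hq)

theorem sup3 {a x : V} {α : F} : x ∈ eigSp F a 1 ⊔ eigSp F a 0 ⊔ eigSp F a α ↔
    ∃ p ∈ eigSp F a 1, ∃ q ∈ eigSp F a 0, ∃ r ∈ eigSp F a α, x = p + q + r := by
  constructor
  · intro h
    obtain ⟨y, hy, r, hr, e⟩ := Submodule.mem_sup.1 h
    obtain ⟨p, hp, q, hq, e'⟩ := Submodule.mem_sup.1 hy
    exact ⟨p, hp, q, hq, r, hr, by rw [e', e]⟩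
  · rintro ⟨p, hp, q, hq, r, hr, rfl⟩
    exact Submodule.add_mem_sup (Submodule.add_mem_sup hp hq) hr

theorem plus_map {g : V ≃ₗ[F] V} (hg : ∀ x y, g (x * y) = g x * g y) {a x : V} {α : F}
    (h : x ∈ eigSp F a 1 ⊔ eigSp F a 0 ⊔ eigSp F a α) :
    g x ∈ eigSp F (g a) 1 ⊔ eigSp F (g a) 0 ⊔ eigSp F (g a) α := by
  obtain ⟨p, hp, q, hq, r, hr, rfl⟩ := sup3.1 h
  exact sup3.2 ⟨_, eig_map hg hp, _, eig_map hg hq, _, eig_map hg hr, by simp⟩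

theorem IsAxis.dec {α β : F} {a : V} (h : IsAxis F α β a) (x : V) :
    ∃ y ∈ eigSp F a 1 ⊔ eigSp F a 0 ⊔ eigSp F a α, ∃ z ∈ eigSp F a β, x = y + z := by
  have : x ∈ eigSp F a 1 ⊔ eigSp F a 0 ⊔ eigSp F a α ⊔ eigSp F a β := by rw [h.decomp]; trivial
  obtain ⟨y, hy, z, hz, e⟩ := Submodule.mem_sup.1 this
  exact ⟨y, hy, z, hz, e.symm⟩

theorem IsAxis.proj {α β : F} {a : V} (h : IsAxis F α β a) (x : V) : ∃ l, HasProj F α β a x l := by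
  obtain ⟨y, hy, z, hz, rfl⟩ := h.dec x
  obtain ⟨p, hp, q, hq, r, hr, rfl⟩ := sup3.1 hy
  rw [h.primitive] at hp
  obtain ⟨c, rfl⟩ := Submodule.mem_span_singleton.1 hp
  exact ⟨c, q, hq, r, hr, z, hz, rfl⟩

theorem IsAxis.pax {α β : F} {a : V} (h : IsAxis F α β a) : PAx α β a :=
  ⟨h.idem, h.fusion_zero_zero, h.fusion_zero_alpha, h.fusion_alpha_alpha⟩

theorem IsMiyamoto.invol {α β : F} {a : V} {τ : V ≃ₗ[F] V} (h : IsAxis F α β a)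
    (t : IsMiyamoto F α β a τ) (x : V) : τ (τ x) = x := by
  obtain ⟨y, hy, z, hz, rfl⟩ := h.dec x
  rw [map_add, t.fix_plus y hy, t.neg_beta z hz, map_add, map_neg, t.fix_plus y hy,
    t.neg_beta z hz, neg_neg]

theorem IsMiyamoto.anti {α β : F} {a : V} {τ : V ≃ₗ[F] V} (h : IsAxis F α β a)
    (t : IsMiyamoto F α β a τ) (x : V) : x - τ x ∈ eigSp F a β := by
  obtain ⟨y, hy, z, hz, rfl⟩ := h.dec x
  rw [map_add, t.fix_plus y hy, t.neg_beta z hz]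
  convert add_mem hz hz using 1; abel

theorem IsMiyamoto.plus {α β : F} {a : V} {τ : V ≃ₗ[F] V} (h : IsAxis F α β a)
    (t : IsMiyamoto F α β a τ) (x : V) :
    x + τ x ∈ eigSp F a 1 ⊔ eigSp F a 0 ⊔ eigSp F a α := by
  obtain ⟨y, hy, z, hz, rfl⟩ := h.dec x
  rw [map_add, t.fix_plus y hy, t.neg_beta z hz]
  convert add_mem hy hy using 1; abel

theorem IsMiyamoto.fixa {α β : F} {a : V} {τ : V ≃ₗ[F] V} (h : IsAxis F α β a)
    (t : IsMiyamoto F α β a τ) : τ a = a :=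
  t.fix_plus a (Submodule.mem_sup_left (Submodule.mem_sup_left (by
    rw [mem_eig, h.idem, one_smul])))

theorem axSeq_even (a₀ a₁ : V) (τ₀ τ₁ : V ≃ₗ[F] V) (k : ℤ) :
    axSeq F a₀ a₁ τ₀ τ₁ (2 * k) = ((τ₁ * τ₀) ^ k) a₀ := by
  unfold axSeq
  rw [if_pos (by omega), show 2 * k / 2 = k by omega]

theorem axSeq_odd (a₀ a₁ : V) (τ₀ τ₁ : V ≃ₗ[F] V) (k : ℤ) :
    axSeq F a₀ a₁ τ₀ τ₁ (2 * k + 1) = ((τ₁ * τ₀) ^ k) a₁ := by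
  unfold axSeq
  rw [if_neg (by omega), show (2 * k + 1 - 1) / 2 = k by omega]

theorem axSeq_refl {a₀ a₁ : V} {τ₀ τ₁ : V ≃ₗ[F] V} (i0 : ∀ x, τ₀ (τ₀ x) = x)
    (i1 : ∀ x, τ₁ (τ₁ x) = x) (f0 : τ₀ a₀ = a₀) (f1 : τ₁ a₁ = a₁) (i : ℤ) :
    τ₀ (axSeq F a₀ a₁ τ₀ τ₁ i) = axSeq F a₀ a₁ τ₀ τ₁ (0 - i) ∧
    τ₁ (axSeq F a₀ a₁ τ₀ τ₁ i) = axSeq F a₀ a₁ τ₀ τ₁ (2 - i) := by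
  have e0 : τ₀ * τ₀ = 1 := LinearEquiv.ext i0
  have e1 : τ₁ * τ₁ = 1 := LinearEquiv.ext i1
  have v0 : τ₀⁻¹ = τ₀ := inv_eq_of_mul_eq_one_left e0
  have v1 : τ₁⁻¹ = τ₁ := inv_eq_of_mul_eq_one_left e1
  have ri : (τ₁ * τ₀)⁻¹ = τ₀ * τ₁ := by rw [mul_inv_rev, v0, v1]
  have c0 : ∀ k : ℤ, τ₀ * (τ₁ * τ₀) ^ k = (τ₁ * τ₀) ^ (-k) * τ₀ := by
    intro k
    have : τ₀ * (τ₁ * τ₀) * τ₀⁻¹ = (τ₁ * τ₀)⁻¹ := by rw [ri]; group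
    rw [zpow_neg, ← inv_zpow, ← this, conj_zpow]; group
  have c1 : ∀ k : ℤ, τ₁ * (τ₁ * τ₀) ^ k = (τ₁ * τ₀) ^ (-k) * τ₁ := by
    intro k
    have : τ₁ * (τ₁ * τ₀) * τ₁⁻¹ = (τ₁ * τ₀)⁻¹ := by rw [ri, ← mul_assoc, e1, v1, one_mul]
    rw [zpow_neg, ← inv_zpow, ← this, conj_zpow]; group
  obtain ⟨k, hk⟩ : ∃ k, i = 2 * k ∨ i = 2 * k + 1 := ⟨i / 2, by omega⟩
  rcases hk with rfl | rfl
  · rw [show 0 - 2 * k = 2 * (-k) by ring, show 2 - 2 * k = 2 * (-k + 1) by ring]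
    simp only [axSeq_even]
    constructor
    · rw [← LinearEquiv.mul_apply, c0, LinearEquiv.mul_apply, f0]
    · rw [← LinearEquiv.mul_apply, c1, zpow_add, zpow_one]
      simp only [LinearEquiv.mul_apply, f0]
  · rw [show 0 - (2 * k + 1) = 2 * (-k + -1) + 1 by ring,
      show 2 - (2 * k + 1) = 2 * (-k) + 1 by ring]
    simp only [axSeq_odd]
    constructor
    · rw [← LinearEquiv.mul_apply, c0, zpow_add, zpow_neg_one, ri]
      simp only [LinearEquiv.mul_apply, f1]
    · rw [← LinearEquiv.mul_apply, c1, LinearEquiv.mul_apply, f1]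

/-- the setting: axes, involutions, sequence -/
structure Dat (α β : F) (a : ℤ → V) (τ₀ τ₁ : V ≃ₗ[F] V) : Prop where
  x0 : IsAxis F α β (a 0)
  x1 : IsAxis F α β (a 1)
  m0 : IsMiyamoto F α β (a 0) τ₀
  m1 : IsMiyamoto F α β (a 1) τ₁
  t0 : ∀ i, τ₀ (a i) = a (0 - i)
  t1 : ∀ i, τ₁ (a i) = a (2 - i)

theorem par_ind {Q : ℤ → Prop} (q0 : Q 0) (q1 : Q 1) (r0 : ∀ i, Q i → Q (0 - i))
    (r1 : ∀ i, Q i → Q (2 - i)) (i : ℤ) : Q i := by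
  have up : ∀ i, Q i → Q (i + 2) := fun i h => by
    have := r1 _ (r0 i h); rwa [show 2 - (0 - i) = i + 2 by ring] at this
  have dn : ∀ i, Q i → Q (i - 2) := fun i h => by
    have := r0 _ (r1 i h); rwa [show 0 - (2 - i) = i - 2 by ring] at this
  have : Q i ∧ Q (i + 1) := by
    induction i using Int.induction_on with
    | zero => exact ⟨q0, q1⟩
    | succ i ih => exact ⟨ih.2, by have := up _ ih.1; rwa [add_assoc]⟩
    | pred i ih =>
      refine ⟨?_, by rw [sub_add_cancel]; exact ih.1⟩
      have := dn _ ih.2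
      rwa [show -(i : ℤ) + 1 - 2 = -i - 1 by ring] at this
  exact this.1

theorem Dat.projAll {α β l : F} {a : ℤ → V} {τ₀ τ₁ : V ≃ₗ[F] V} (D : Dat α β a τ₀ τ₁) (d : ℤ)
    (h0 : HasProj F α β (a 0) (a d) l) (h1 : HasProj F α β (a 1) (a (1 - d)) l) (i : ℤ) :
    HasProj F α β (a i) (a (i + d)) l := by
  suffices H : HasProj F α β (a i) (a (i + d)) l ∧ HasProj F α β (a i) (a (i - d)) l from H.1
  refine par_ind (Q := fun i => HasProj F α β (a i) (a (i + d)) l ∧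
    HasProj F α β (a i) (a (i - d)) l) ?_ ?_ ?_ ?_ i
  · refine ⟨by simpa using h0, ?_⟩
    have := h0.map D.m0.map_mul
    simpa [D.t0] using this
  · refine ⟨?_, h1⟩
    have := h1.map D.m1.map_mul
    rw [D.t1, D.t1] at this
    rwa [show 2 - (1 - d) = 1 + d by ring] at this
  · rintro i ⟨h, h'⟩
    have e := h.map D.m0.map_mul
    have e' := h'.map D.m0.map_mul
    simp only [D.t0] at e e'
    rw [show 0 - (i + d) = 0 - i - d by ring] at e
    rw [show 0 - (i - d) = 0 - i + d by ring] at e'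
    exact ⟨e', e⟩
  · rintro i ⟨h, h'⟩
    have e := h.map D.m1.map_mul
    have e' := h'.map D.m1.map_mul
    simp only [D.t1] at e e'
    rw [show 2 - (i + d) = 2 - i - d by ring] at e
    rw [show 2 - (i - d) = 2 - i + d by ring] at e'
    exact ⟨e', e⟩

theorem Dat.pre {α β l1 l2 : F} {a : ℤ → V} {τ₀ τ₁ : V ≃ₗ[F] V} (D : Dat α β a τ₀ τ₁)
    (h1 : HasProj F α β (a 0) (a 1) l1) (h1' : HasProj F α β (a 1) (a 0) l1)
    (h2 : HasProj F α β (a 0) (a 2) l2) (h2' : HasProj F α β (a 1) (a (-1)) l2) :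
    Pre α β l1 l2 a where
  ax := by
    refine par_ind D.x0.pax D.x1.pax ?_ ?_
    · intro i h; rw [← D.t0]; exact h.map D.m0.map_mul
    · intro i h; rw [← D.t1]; exact h.map D.m1.map_mul
  anti := by
    refine par_ind (Q := fun i => ∀ n, a (i + n) - a (i - n) ∈ eigSp F (a i) β) ?_ ?_ ?_ ?_
    · intro n
      have := D.m0.anti D.x0 (a n)
      rw [D.t0] at this; simpa using this
    · intro n
      have := D.m1.anti D.x1 (a (1 + n))
      rw [D.t1] at this; rwa [show 2 - (1 + n) = 1 - n by ring] at this
    · intro i h n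
      have := eig_map D.m0.map_mul (h (-n))
      rw [map_sub, D.t0, D.t0, D.t0] at this
      rwa [show 0 - (i + -n) = 0 - i + n by ring, show 0 - (i - -n) = 0 - i - n by ring] at this
    · intro i h n
      have := eig_map D.m1.map_mul (h (-n))
      rw [map_sub, D.t1, D.t1, D.t1] at this
      rwa [show 2 - (i + -n) = 2 - i + n by ring, show 2 - (i - -n) = 2 - i - n by ring] at this
  plus := by
    refine par_ind (Q := fun i => ∀ n, a (i + n) + a (i - n) ∈
      eigSp F (a i) 1 ⊔ eigSp F (a i) 0 ⊔ eigSp F (a i) α) ?_ ?_ ?_ ?_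
    · intro n
      have := D.m0.plus D.x0 (a n)
      rw [D.t0] at this; simpa using this
    · intro n
      have := D.m1.plus D.x1 (a (1 + n))
      rw [D.t1] at this; rwa [show 2 - (1 + n) = 1 - n by ring] at this
    · intro i h n
      have := plus_map D.m0.map_mul (h (-n))
      rw [map_add, D.t0, D.t0, D.t0] at this
      rwa [show 0 - (i + -n) = 0 - i + n by ring, show 0 - (i - -n) = 0 - i - n by ring] at this
    · intro i h n
      have := plus_map D.m1.map_mul (h (-n))
      rw [map_add, D.t1, D.t1, D.t1] at this
      rwa [show 2 - (i + -n) = 2 - i + n by ring, show 2 - (i - -n) = 2 - i - n by ring] at this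
  p1 := D.projAll 1 h1 (by simpa using h1')
  p2 := D.projAll 2 h2 (by norm_num; exact h2')

instance prodNN (A : Type v) [NonUnitalNonAssocCommRing A] : NonUnitalNonAssocCommRing (A × A) :=
  { (inferInstance : NonUnitalNonAssocRing (A × A)) with
    mul_comm := fun x y => Prod.ext (mul_comm _ _) (mul_comm _ _) }

theorem eig_prod {a b x y : V} {μ : F} :
    (x, y) ∈ eigSp F (a, b) μ ↔ x ∈ eigSp F a μ ∧ y ∈ eigSp F b μ := by
  simp only [mem_eig, Prod.mk_mul_mk, Prod.smul_mk, Prod.mk.injEq]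

theorem HasProj.prod {α β l : F} {a b x y : V} (h : HasProj F α β a x l)
    (h' : HasProj F α β b y l) : HasProj F α β (a, b) (x, y) l := by
  obtain ⟨v0, h0, v1, h1, v2, h2, rfl⟩ := h
  obtain ⟨w0, k0, w1, k1, w2, k2, rfl⟩ := h'
  exact ⟨(v0, w0), eig_prod.2 ⟨h0, k0⟩, (v1, w1), eig_prod.2 ⟨h1, k1⟩, (v2, w2),
    eig_prod.2 ⟨h2, k2⟩, by simp⟩

theorem PAx.prod {α β : F} {a b : V} (h : PAx α β a) (k : PAx α β b) :
    PAx α β ((a, b) : V × V) where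
  idem := by rw [Prod.mk_mul_mk, h.idem, k.idem]
  f00 u hu w hw := eig_prod.2 ⟨h.f00 _ (eig_prod.1 hu).1 _ (eig_prod.1 hw).1,
    k.f00 _ (eig_prod.1 hu).2 _ (eig_prod.1 hw).2⟩
  f0a u hu w hw := eig_prod.2 ⟨h.f0a _ (eig_prod.1 hu).1 _ (eig_prod.1 hw).1,
    k.f0a _ (eig_prod.1 hu).2 _ (eig_prod.1 hw).2⟩
  faa u hu w hw := by
    obtain ⟨p, hp, q, hq, e⟩ :=
      Submodule.mem_sup.1 (h.faa _ (eig_prod.1 hu).1 _ (eig_prod.1 hw).1)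
    obtain ⟨p', hp', q', hq', e'⟩ :=
      Submodule.mem_sup.1 (k.faa _ (eig_prod.1 hu).2 _ (eig_prod.1 hw).2)
    have : u * w = (p, p') + (q, q') := by
      rw [Prod.mk_add_mk, e, e']; rfl
    rw [this]
    exact Submodule.add_mem_sup (eig_prod.2 ⟨hp, hp'⟩) (eig_prod.2 ⟨hq, hq'⟩)

theorem Pre.prod {α β l1 l2 : F} {a b : ℤ → V} (H : Pre α β l1 l2 a) (K : Pre α β l1 l2 b) :
    Pre α β l1 l2 (fun i => (a i, b i)) where
  ax i := (H.ax i).prod (K.ax i)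
  anti i n := eig_prod.2 ⟨H.anti i n, K.anti i n⟩
  plus i n := by
    obtain ⟨p, hp, q, hq, r, hr, e⟩ := sup3.1 (H.plus i n)
    obtain ⟨p', hp', q', hq', r', hr', e'⟩ := sup3.1 (K.plus i n)
    exact sup3.2 ⟨(p, p'), eig_prod.2 ⟨hp, hp'⟩, (q, q'), eig_prod.2 ⟨hq, hq'⟩, (r, r'),
      eig_prod.2 ⟨hr, hr'⟩, by simp [e, e']⟩
  p1 i := (H.p1 i).prod (K.p1 i)
  p2 i := (H.p2 i).prod (K.p2 i)

theorem Pre.flip {α β l1 l2 : F} {a : ℤ → V} (H : Pre α β l1 l2 a) :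
    Pre α β l1 l2 (fun i => a (1 - i)) := by
  have := H.refl.shift (-1)
  convert this using 3; ring

/-- projection is multiplicative with respect to the axis -/
theorem HasProj.mul {α β l : F} {a x : V} (ha : a * a = a) (h : HasProj F α β a x l) :
    HasProj F α β a (a * x) l := by
  obtain ⟨v0, h0, v1, h1, v2, h2, rfl⟩ := h
  refine ⟨0, zero_mem _, α • v1, Submodule.smul_mem _ _ h1, β • v2, Submodule.smul_mem _ _ h2, ?_⟩
  rw [mem_eig] at h0 h1 h2
  simp only [mul_add, mul_smul_comm, ha, h0, h1, h2]; module

theorem Pre.omega_l3 {α β l3 : F} {a : ℤ → V} (P : Par α β) (H : Pre α β 1 1 a)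
    (h4 : α = 4 * β) (hb : 2 * β = 1) (hc : ∀ r, SS β a r 2 = SS β a 0 2)
    (h3 : ∀ i, HasProj F α β (a i) (a (i + 3)) l3) (h0 : a 0 ≠ 0) : l3 = 1 := by
  have D := fun i => H.relD2 P h4 hb rfl hc i (h3 i)
    (by have := h3 (i + 1); rwa [show i + 1 + 3 = i + 4 by ring] at this)
  have D0 := D 0
  have D1 := D 1
  have D2 := D 2
  have e := H.SS_step 0 3
  norm_num at D0 D1 D2 e
  have h8 : (8 : F) ≠ 0 := by
    rw [show (8 : F) = 2 * 2 * 2 by norm_num]; exact mul_ne_zero (mul_ne_zero P.two P.two) P.two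
  have k : (8 * (l3 - 1)) • (a 0 - a 3) = 0 := by
    linear_combination (norm := module) D0 + D1 + D2 - (5 : F) • e
  rcases smul_eq_zero.1 k with k | k
  · exact sub_eq_zero.1 ((mul_eq_zero.1 k).resolve_left h8)
  · have := h3 0
    rw [zero_add, ← sub_eq_zero.1 k] at this
    exact this.unique P (H.ax 0).idem h0 HasProj.self

theorem omega_ss {α β : F} {a : V} (h : PAx α β a) {M M' S S' : V} {l l' : F}
    (t : Tri α β l a M S) (t' : Tri α β l' a M' S')
    (hM : ∀ x, HasProj F α β a x 0 → HasProj F α β a (M * x) 0)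
    (hM' : ∀ x, HasProj F α β a x 0 → HasProj F α β a (M' * x) 0)
    (hS' : HasProj F α β a S' 0) : HasProj F α β a (S * S') 0 := by
  have u0 := t.u0
  have u0' := t'.u0
  have p := HasProj.ezero (α := α) (β := β) (h.f00 _ u0 _ u0')
  have q := HasProj.ezero (α := α) (β := β) u0
  set u := (α - β) • M - S + (2 * cc α β l) • a with hu
  refine ((((((hM _ hS').smul (α - β)).add ((hS'.mul h.idem).smul (2 * cc α β l))).sub
    ((hM' _ q).smul (α - β))).sub ((q.mul h.idem).smul (2 * cc α β l'))).add p).congr ?_ (by ring)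
  simp only [hu, mul_add, add_mul, mul_sub, sub_mul, mul_smul_comm, smul_mul_assoc, h.idem,
    mul_comm M' M, mul_comm M' S, mul_comm M' a, mul_comm S a, mul_comm M a]
  module

theorem Dat.omega {α β l3 : F} {a : ℤ → V} {τ₀ τ₁ : V ≃ₗ[F] V} (P : Par α β)
    (D : Dat α β a τ₀ τ₁) (H : Pre α β 1 1 a) (h4 : α = 4 * β) (hb : 2 * β = 1)
    (hc : ∀ r, SS β a r 2 = SS β a 0 2)
    (h3 : ∀ i, HasProj F α β (a i) (a (i + 3)) l3)
    (sp : Submodule.span F ({a (-2), a (-1), a 0, a 1, a 2, a 3,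
          a 0 * a 1 - β • (a 0 + a 1), a 0 * a 2 - β • (a 0 + a 2)} : Set V) = ⊤) :
    Good α β ((a 0, a 1) : V × V) (a 1, a 0) := by
  have p10 : HasProj F α β (a 1) (a 0) 1 := H.projneg (H.p1 1)
  have p01 : HasProj F α β (a 0) (a 1) 1 := H.p1 0
  have i0 := (H.ax 0).idem
  have i1 := (H.ax 1).idem
  by_cases z0 : a 0 = 0
  · have z1 : a 1 = 0 := by
      rw [z0] at p10
      simpa using HasProj.zero_smul P i1 p10
    refine ⟨⊥, by simp [z0, z1], by simp [z0, z1], ?_, ?_⟩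
    · intro x hx y hy; rw [Submodule.mem_bot] at *; simp [hx]
    · intro x hx
      rw [Submodule.mem_bot] at hx
      exact ⟨0, HasProj.ezero (by rw [hx]; exact zero_mem _)⟩
  have z1 : a 1 ≠ 0 := by
    intro h
    rw [h] at p01
    exact z0 (by simpa using HasProj.zero_smul P i0 p01)
  have e3 := H.omega_l3 P h4 hb hc h3 z0
  subst e3
  have ind : ∀ {Q : V → Prop}, (∀ x y, Q x → Q y → Q (x + y)) → (∀ (c : F) x, Q x → Q (c • x)) →
      (a (-2) ∈ {x | Q x} ∧ Q (a (-1)) ∧ Q (a 0) ∧ Q (a 1) ∧ Q (a 2) ∧ Q (a 3)) →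
      Q (SS β a 0 1) → Q (SS β a 0 2) → ∀ x, Q x := by
    rintro Q qa qs ⟨qm2, qm1, q0, q1, q2, q3⟩ s1 s2 x
    have s1' : Q (a 0 * a 1 - β • (a 0 + a 1)) := by
      convert qs (2 : F)⁻¹ _ s1 using 1
      rw [eq_comm, inv_smul_eq_iff₀ P.two]; unfold SS; rw [zero_add]; module
    have s2' : Q (a 0 * a 2 - β • (a 0 + a 2)) := by
      convert qs (2 : F)⁻¹ _ s2 using 1
      rw [eq_comm, inv_smul_eq_iff₀ P.two]; unfold SS; rw [zero_add]; module
    have hx : x ∈ Submodule.span F ({a (-2), a (-1), a 0, a 1, a 2, a 3,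
          a 0 * a 1 - β • (a 0 + a 1), a 0 * a 2 - β • (a 0 + a 2)} : Set V) := by rw [sp]; trivial
    induction hx using Submodule.span_induction with
    | mem y hy =>
      simp only [Set.mem_insert_iff, Set.mem_singleton_iff] at hy
      rcases hy with rfl | rfl | rfl | rfl | rfl | rfl | rfl | rfl <;> assumption
    | zero => simpa using qs 0 _ q0
    | add x y _ _ hx hy => exact qa x y hx hy
    | smul c x _ hx => exact qs c x hx
  have hS : ∀ i, HasProj F α β (a i) (SS β a 0 1) 0 := fun i =>
    ((H.tri1 P i).pS P).congr rfl (by linear_combination -2 * hb)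
  have hS2 : ∀ i, HasProj F α β (a i) (SS β a 0 2) 0 := fun i =>
    (H.projSi P i).congr (hc i) (by linear_combination -2 * hb)
  have R : ∀ x, ∃ c, HasProj F α β (a 0) x c ∧ HasProj F α β (a 1) x c := by
    refine ind ?_ ?_ ⟨?_, ?_, ?_, ?_, ?_, ?_⟩ ⟨0, hS 0, hS 1⟩ ⟨0, hS2 0, hS2 1⟩
    · rintro x y ⟨c, h, k⟩ ⟨d, h', k'⟩; exact ⟨c + d, h.add h', k.add k'⟩
    · rintro c x ⟨d, h, k⟩; exact ⟨c * d, h.smul c, k.smul c⟩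
    · exact ⟨1, H.projneg (H.p2 0), H.projneg (h3 1)⟩
    · exact ⟨1, H.projneg (H.p1 0), H.projneg (H.p2 1)⟩
    · exact ⟨1, HasProj.self, p10⟩
    · exact ⟨1, p01, HasProj.self⟩
    · exact ⟨1, H.p2 0, H.p1 1⟩
    · exact ⟨1, h3 0, H.p2 1⟩
  have r01 : ∀ x c, HasProj F α β (a 0) x c → HasProj F α β (a 1) x c := by
    intro x c h
    obtain ⟨d, h0, h1⟩ := R x
    rwa [h.unique P i0 z0 h0]
  have r10 : ∀ x c, HasProj F α β (a 1) x c → HasProj F α β (a 0) x c := by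
    intro x c h
    obtain ⟨d, h0, h1⟩ := R x
    rwa [h.unique P i1 z1 h1]
  have f0 : ∀ x c, HasProj F α β (a 0) x c → HasProj F α β (a 0) (τ₀ x) c := by
    intro x c h
    have := h.map D.m0.map_mul
    rwa [D.t0, sub_zero] at this
  have f1 : ∀ x c, HasProj F α β (a 0) x c → HasProj F α β (a 0) (τ₁ x) c := by
    intro x c h
    have := (r01 _ _ h).map D.m1.map_mul
    rw [D.t1] at this
    exact r10 _ _ this
  have E : ∀ j x c, HasProj F α β (a 0) x c → HasProj F α β (a 0) (a j * x) c := by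
    refine par_ind ?_ ?_ ?_ ?_
    · intro x c h; exact h.mul i0
    · intro x c h; exact r10 _ _ ((r01 _ _ h).mul i1)
    · intro i h x c k
      have := f0 _ _ (h _ _ (f0 _ _ k))
      rwa [D.m0.map_mul, D.t0, D.m0.invol D.x0] at this
    · intro i h x c k
      have := f1 _ _ (h _ _ (f1 _ _ k))
      rwa [D.m1.map_mul, D.t1, D.m1.invol D.x1] at this
  have eM : ∀ i j x, HasProj F α β (a 0) x 0 → HasProj F α β (a 0) ((a i + a j) * x) 0 := by
    intro i j x h
    exact ((E i x 0 h).add (E j x 0 h)).congr (by rw [add_mul]) (by ring)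
  have t1 := H.tri P (H.p1 0)
  have t2 := H.tri P (H.p2 0)
  have s11 := omega_ss (H.ax 0) t1 t1 (eM _ _) (eM _ _) (hS 0)
  have s12 := omega_ss (H.ax 0) t1 t2 (eM _ _) (eM _ _) (hS2 0)
  have s22 := omega_ss (H.ax 0) t2 t2 (eM _ _) (eM _ _) (hS2 0)
  have SQ : ∀ S, HasProj F α β (a 0) S 0 → HasProj F α β (a 0) (S * SS β a 0 1) 0 →
      HasProj F α β (a 0) (S * SS β a 0 2) 0 → ∀ y, HasProj F α β (a 0) (S * y) 0 := by
    intro S h h1 h2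
    have hj : ∀ j, HasProj F α β (a 0) (S * a j) 0 := fun j => by rw [mul_comm]; exact E j S 0 h
    refine ind ?_ ?_ ⟨hj _, hj _, hj _, hj _, hj _, hj _⟩ h1 h2
    · intro x y k k'; exact (k.add k').congr (by rw [mul_add]) (by ring)
    · intro c x k; exact (k.smul c).congr (by rw [mul_smul_comm]) (by ring)
  have Q : ∀ x, ∃ c, HasProj F α β (a 0) x c ∧ ∀ y d, HasProj F α β (a 0) y d →
      HasProj F α β (a 0) (x * y) (c * d) := by
    have qj : ∀ j, HasProj F α β (a 0) (a j) 1 → ∃ c, HasProj F α β (a 0) (a j) c ∧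
        ∀ y d, HasProj F α β (a 0) y d → HasProj F α β (a 0) (a j * y) (c * d) := by
      intro j h
      exact ⟨1, h, fun y d k => by rw [one_mul]; exact E j y d k⟩
    refine ind ?_ ?_ ⟨qj _ ?_, qj _ ?_, qj _ ?_, qj _ ?_, qj _ ?_, qj _ ?_⟩ ?_ ?_
    · rintro x y ⟨c, h, k⟩ ⟨d, h', k'⟩
      exact ⟨c + d, h.add h', fun z e m => ((k z e m).add (k' z e m)).congr (by rw [add_mul])
        (by ring)⟩
    · rintro c x ⟨d, h, k⟩
      exact ⟨c * d, h.smul c, fun z e m => ((k z e m).smul c).congr (by rw [smul_mul_assoc])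
        (by ring)⟩
    · exact H.projneg (H.p2 0)
    · exact H.projneg (H.p1 0)
    · exact HasProj.self
    · exact p01
    · exact H.p2 0
    · exact h3 0
    · exact ⟨0, hS 0, fun y d _ => by rw [zero_mul]; exact SQ _ (hS 0) s11 s12 y⟩
    · exact ⟨0, hS2 0, fun y d _ => by
        rw [zero_mul]; exact SQ _ (hS2 0) (by rw [mul_comm]; exact s12) s22 y⟩
  let T : Submodule F (V × V) :=
    { carrier := {p | ∃ c, HasProj F α β (a 0) p.1 c ∧ HasProj F α β (a 0) p.2 c}
      add_mem' := by
        rintro x y ⟨c, h, k⟩ ⟨d, h', k'⟩; exact ⟨c + d, h.add h', k.add k'⟩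
      zero_mem' := ⟨0, HasProj.ezero (zero_mem _), HasProj.ezero (zero_mem _)⟩
      smul_mem' := by
        rintro c x ⟨d, h, k⟩; exact ⟨c * d, h.smul c, k.smul c⟩ }
  refine ⟨T, ⟨1, HasProj.self, p01⟩, ⟨1, p01, HasProj.self⟩, ?_, ?_⟩
  · rintro x ⟨c, h, k⟩ y ⟨d, h', k'⟩
    obtain ⟨e, q, q'⟩ := Q x.1
    obtain ⟨f, r, r'⟩ := Q x.2
    rw [q.unique P i0 z0 h] at q'
    rw [r.unique P i0 z0 k] at r'
    exact ⟨c * d, q' _ _ h', r' _ _ k'⟩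
  · rintro ⟨x, y⟩ ⟨c, h, k⟩
    exact ⟨c, h.prod (r01 _ _ k)⟩

theorem Dat.good {α β l1 l2 : F} {a : ℤ → V} {τ₀ τ₁ : V ≃ₗ[F] V} (P : Par α β)
    (D : Dat α β a τ₀ τ₁) (H : Pre α β l1 l2 a)
    (hside : ¬(α = 2 ∧ β = 1 / 2) ∨
      ((∃ l3 : F, HasProj F α β (a 0) (a 3) l3 ∧ HasProj F α β (a 1) (a (-2)) l3) ∧
        Submodule.span F ({a (-2), a (-1), a 0, a 1, a 2, a 3,
          a 0 * a 1 - β • (a 0 + a 1), a 0 * a 2 - β • (a 0 + a 2)} : Set V) = ⊤)) :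
    Good α β ((a 0, a 1) : V × V) (a 1, a 0) := by
  have K := H.prod H.flip
  have fin : Good α β ((fun i => (a i, a (1 - i)) : ℤ → V × V) 0)
      ((fun i => (a i, a (1 - i)) : ℤ → V × V) 1) → Good α β ((a 0, a 1) : V × V) (a 1, a 0) := by
    intro h; simpa using h
  rcases K.trich P with h | ⟨h4, hm, hn, hh⟩
  · exact fin h
  have hc := H.S2const P h4 hm hn
  by_cases hs : ¬(α = 2 ∧ β = 1 / 2)
  · have nb : ¬ (2 * β = 1) := by
      intro h; exact hs ⟨by rw [h4]; linear_combination 2 * h, by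
        rw [eq_div_iff P.two]; linear_combination h⟩
    rcases hh with ⟨hb, hl, hl2⟩ | ⟨hb, -, -⟩
    swap
    · exact absurd hb nb
    have h5 : (5 : F) ≠ 0 := by
      intro h; apply nb; linear_combination hb - 2 * β * h
    have h2' : (16 : F) ≠ 0 := by
      rw [show (16 : F) = 2 * 2 * 2 * 2 by norm_num]
      exact mul_ne_zero (mul_ne_zero (mul_ne_zero P.two P.two) P.two) P.two
    have e12 : l2 = l1 := mul_left_cancel₀ h2' (by rw [hl, hl2])
    subst e12
    obtain ⟨l3, h3, h3'⟩ : ∃ l3, HasProj F α β (a 0) (a 3) l3 ∧ HasProj F α β (a 1) (a (1 - 3)) l3 := by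
      obtain ⟨m, hm⟩ := D.x1.proj (a (1 - 3))
      by_cases z0 : a 0 = 0
      · refine ⟨m, ?_, hm⟩
        obtain ⟨k, hk⟩ := D.x0.proj (a 3)
        rw [z0] at hk ⊢
        rw [hasProj_iff] at hk ⊢; simpa using hk
      · obtain ⟨k, hk⟩ := D.x0.proj (a 3)
        have g := H.projneg' hm
        have g' := g.map D.m0.map_mul
        rw [D.t0, D.t0] at g'
        have := H.projneg' (i := -1) (n := 3) (l := m) (by norm_num at g' ⊢; exact g')
        have := H.l3eq P h4 hb hl hc hk g (by norm_num at this; exact this) z0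
        exact ⟨m, this ▸ hk, hm⟩
    have A := D.projAll 3 h3 h3'
    refine fin (K.case12 (l3 := l3) P h4 hb hl h5 hm hn ?_)
    intro i
    refine (A i).prod ?_
    have := H.projneg (A (1 - i))
    rwa [show 1 - i - 3 = 1 - (i + 3) by ring] at this
  · obtain ⟨⟨l3, h3, h3'⟩, sp⟩ := hside.resolve_left hs
    have A := D.projAll 3 h3 (by norm_num; exact h3')
    have hb : 2 * β = 1 := by
      rw [(not_not.1 hs).2]; exact mul_one_div_cancel P.two
    have hl : l1 = 1 ∧ l2 = 1 := by
      rcases hh with ⟨hb', hl, hl2⟩ | ⟨-, hl, hl2⟩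
      · have h5 : (5 : F) = 0 := by linear_combination hb' - 6 * hb
        exact ⟨by linear_combination hl - 3 * l1 * h5, by linear_combination hl2 - 3 * l2 * h5⟩
      · exact ⟨hl, hl2⟩
    obtain ⟨rfl, rfl⟩ := hl
    exact D.omega P H h4 hb hc A sp

/-- fusion rules needed -/
structure FAx (α β : F) (a : V) : Prop extends PAx α β a where
  f0b : ∀ u ∈ eigSp F a 0, ∀ w ∈ eigSp F a β, u * w ∈ eigSp F a β
  fab : ∀ u ∈ eigSp F a α, ∀ w ∈ eigSp F a β, u * w ∈ eigSp F a β
  fbb : ∀ u ∈ eigSp F a β, ∀ w ∈ eigSp F a β, u * w ∈ eigSp F a 1 ⊔ eigSp F a 0 ⊔ eigSp F a α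

theorem IsAxis.fax {α β : F} {a : V} (h : IsAxis F α β a) : FAx α β a :=
  { h.pax with
    f0b := h.fusion_zero_beta
    fab := h.fusion_alpha_beta
    fbb := h.fusion_beta_beta }

theorem FAx.prod {α β : F} {a b : V} (h : FAx α β a) (k : FAx α β b) :
    FAx α β ((a, b) : V × V) :=
  { h.toPAx.prod k.toPAx with
    f0b := fun u hu w hw => eig_prod.2 ⟨h.f0b _ (eig_prod.1 hu).1 _ (eig_prod.1 hw).1,
      k.f0b _ (eig_prod.1 hu).2 _ (eig_prod.1 hw).2⟩
    fab := fun u hu w hw => eig_prod.2 ⟨h.fab _ (eig_prod.1 hu).1 _ (eig_prod.1 hw).1,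
      k.fab _ (eig_prod.1 hu).2 _ (eig_prod.1 hw).2⟩
    fbb := fun u hu w hw => by
      obtain ⟨p, hp, q, hq, r, hr, e⟩ := sup3.1 (h.fbb _ (eig_prod.1 hu).1 _ (eig_prod.1 hw).1)
      obtain ⟨p', hp', q', hq', r', hr', e'⟩ :=
        sup3.1 (k.fbb _ (eig_prod.1 hu).2 _ (eig_prod.1 hw).2)
      refine sup3.2 ⟨(p, p'), eig_prod.2 ⟨hp, hp'⟩, (q, q'), eig_prod.2 ⟨hq, hq'⟩, (r, r'),
        eig_prod.2 ⟨hr, hr'⟩, Prod.ext e e'⟩ }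

section pull
variable {X : Type*} [NonUnitalNonAssocCommRing X] [Module F X] [SMulCommClass F X X]
  [IsScalarTower F X X] {U : Type*} [NonUnitalNonAssocCommRing U] [Module F U]
  [SMulCommClass F U U] [IsScalarTower F U U]

theorem eig_pull {ι : X →ₗ[F] U} (inj : Function.Injective ι) (mul : ∀ x y, ι (x * y) = ι x * ι y)
    {b x : X} {μ : F} : x ∈ eigSp F b μ ↔ ι x ∈ eigSp F (ι b) μ := by
  rw [mem_eig, mem_eig, ← mul, ← map_smul]; exact inj.eq_iff.symm

theorem HasProj.pull {α β : F} (P : Par α β) {ι : X →ₗ[F] U} (inj : Function.Injective ι)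
    (mul : ∀ x y, ι (x * y) = ι x * ι y) {b x : X} {l : F} (hb : b * b = b)
    (h : HasProj F α β (ι b) (ι x) l) : HasProj F α β b x l := by
  obtain ⟨v0, h0, v1, h1, v2, h2, e⟩ := h
  have i0 := mem_eig.1 h0
  have i1 := mem_eig.1 h1
  have i2 := mem_eig.1 h2
  have hi : ι b * ι b = ι b := by rw [← mul, hb]
  set z1 := b * x - l • b with hz1
  have e1 : ι z1 = α • v1 + β • v2 := by
    rw [hz1, map_sub, mul, map_smul, e]
    simp only [mul_add, mul_smul_comm, hi, i0, i1, i2]; module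
  have e2 : ι (b * z1) = (α * α) • v1 + (β * β) • v2 := by
    rw [mul, e1]
    simp only [mul_add, mul_smul_comm, i1, i2]; module
  have n1 : α * (α - β) ≠ 0 := mul_ne_zero P.a0 (sub_ne_zero.2 P.ab)
  have n2 : β * (β - α) ≠ 0 := mul_ne_zero P.b0 (sub_ne_zero.2 P.ab.symm)
  set xa := (α * (α - β))⁻¹ • (b * z1 - β • z1) with hxa
  set xb := (β * (β - α))⁻¹ • (b * z1 - α • z1) with hxb
  have ea : ι xa = v1 := by
    rw [hxa, map_smul, inv_smul_eq_iff₀ n1, map_sub, e2, map_smul, e1]; module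
  have eb : ι xb = v2 := by
    rw [hxb, map_smul, inv_smul_eq_iff₀ n2, map_sub, e2, map_smul, e1]; module
  refine ⟨x - l • b - xa - xb, ?_, xa, ?_, xb, ?_, by module⟩
  · rw [eig_pull inj mul]
    convert h0 using 1
    rw [map_sub, map_sub, map_sub, map_smul, ea, eb, e]; module
  · rw [eig_pull inj mul, ea]; exact h1
  · rw [eig_pull inj mul, eb]; exact h2

theorem axis_pull {α β : F} (P : Par α β) {ι : X →ₗ[F] U} (inj : Function.Injective ι)
    (mul : ∀ x y, ι (x * y) = ι x * ι y) {b : X} (h : FAx α β (ι b))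
    (pr : ∀ x, ∃ l, HasProj F α β (ι b) (ι x) l) : IsAxis F α β b := by
  have hb : b * b = b := inj (by rw [mul, h.idem])
  have E : ∀ {x : X} {μ : F}, x ∈ eigSp F b μ ↔ ι x ∈ eigSp F (ι b) μ := eig_pull inj mul
  have b1 : b ∈ eigSp F b 1 := by rw [mem_eig, hb, one_smul]
  have prim : eigSp F b 1 = Submodule.span F {b} := by
    apply le_antisymm
    · intro x hx
      obtain ⟨l, hl⟩ := pr x
      rw [(hl.pull P inj mul hb).one_eq P hx hb]
      exact Submodule.smul_mem _ _ (Submodule.mem_span_singleton_self b)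
    · rw [Submodule.span_singleton_le_iff_mem]; exact b1
  have one : ∀ u ∈ eigSp F b 1, ∀ μ : F, ∀ w ∈ eigSp F b μ, ∃ c : F, u * w = c • μ • w := by
    intro u hu μ w hw
    rw [prim] at hu
    obtain ⟨c, rfl⟩ := Submodule.mem_span_singleton.1 hu
    exact ⟨c, by rw [smul_mul_assoc, mem_eig.1 hw]⟩
  refine ⟨hb, prim, ?_, ?_, ?_, ?_, ?_, ?_, ?_, ?_, ?_, ?_⟩
  · rw [eq_top_iff]
    intro x _
    obtain ⟨l, hl⟩ := pr x
    obtain ⟨v0, h0, v1, h1, v2, h2, rfl⟩ := hl.pull P inj mul hb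
    exact Submodule.add_mem_sup (Submodule.add_mem_sup (Submodule.add_mem_sup
      (Submodule.smul_mem _ _ b1) h0) h1) h2
  · intro u hu w hw
    obtain ⟨c, e⟩ := one u hu 0 w hw
    rw [e]; simp
  · intro u hu w hw
    obtain ⟨c, e⟩ := one u hu _ w hw
    rw [e]; exact Submodule.smul_mem _ _ (Submodule.smul_mem _ _ hw)
  · intro u hu w hw
    obtain ⟨c, e⟩ := one u hu _ w hw
    rw [e]; exact Submodule.smul_mem _ _ (Submodule.smul_mem _ _ hw)
  · intro u hu w hw; rw [E, mul]; exact h.f00 _ (E.1 hu) _ (E.1 hw)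
  · intro u hu w hw; rw [E, mul]; exact h.f0a _ (E.1 hu) _ (E.1 hw)
  · intro u hu w hw; rw [E, mul]; exact h.f0b _ (E.1 hu) _ (E.1 hw)
  · intro u hu w hw
    obtain ⟨p, hp, q, hq, e⟩ := Submodule.mem_sup.1 (h.faa _ (E.1 hu) _ (E.1 hw))
    have ep : ι (b * (u * w)) = p := by
      rw [mul, mul, ← e, mul_add, mem_eig.1 hp, mem_eig.1 hq]; simp
    have : u * w = b * (u * w) + (u * w - b * (u * w)) := by abel
    rw [this]
    refine Submodule.add_mem_sup (E.2 (by rw [ep]; exact hp)) (E.2 ?_)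
    rw [map_sub, ep, mul, ← e]; simpa using hq
  · intro u hu w hw; rw [E, mul]; exact h.fab _ (E.1 hu) _ (E.1 hw)
  · intro u hu w hw
    obtain ⟨p, hp, q, hq, r, hr, e⟩ := sup3.1 (h.fbb _ (E.1 hu) _ (E.1 hw))
    set y := u * w with hy
    have ey : ι y = p + q + r := by rw [hy, mul, e]
    have y1 : ι (b * y) = p + α • r := by
      rw [mul, ey, mul_add, mul_add, mem_eig.1 hp, mem_eig.1 hq, mem_eig.1 hr]; module
    have y2 : ι (b * (b * y)) = p + (α * α) • r := by
      rw [mul, y1, mul_add, mul_smul_comm, mem_eig.1 hp, mem_eig.1 hr]; module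
    have n1 : α * (α - 1) ≠ 0 := mul_ne_zero P.a0 (sub_ne_zero.2 P.a1)
    set x := (α * (α - 1))⁻¹ • (b * (b * y) - b * y) with hx
    have er : ι x = r := by
      rw [hx, map_smul, inv_smul_eq_iff₀ n1, map_sub, y2, y1]; module
    refine sup3.2 ⟨b * y - α • x, E.2 ?_, y - (b * y - α • x) - x, E.2 ?_, x, E.2 ?_, by abel⟩
    · rw [map_sub, y1, map_smul, er]; simpa using hp
    · rw [map_sub, map_sub, map_sub, y1, map_smul, er, ey]
      convert hq using 1; module
    · rw [er]; exact hr

end pull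

theorem quot_of_emb {X : Type (max u v)} [NonUnitalNonAssocCommRing X] [Module F X]
    [SMulCommClass F X X] [IsScalarTower F X X] {α β : F} (P : Par α β) {a₀ a₁ : V}
    (hV : IsTwoGenerated F α β a₀ a₁) (G : Good α β ((a₀, a₁) : V × V) (a₁, a₀))
    (ι : X →ₗ[F] V × V) (inj : Function.Injective ι) (mul : ∀ x y, ι (x * y) = ι x * ι y)
    (b₀ b₁ : X) (e0 : ι b₀ = (a₀, a₁)) (e1 : ι b₁ = (a₁, a₀))
    (gen : NonUnitalAlgebra.adjoin F {b₀, b₁} = ⊤) : IsQuotientOfSymmetric.{u, v} F α β a₀ a₁ := by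
  obtain ⟨T, t0, t1, tm, tp⟩ := G
  have ind : ∀ {Q : X → Prop}, Q b₀ → Q b₁ → (∀ x y, Q x → Q y → Q (x + y)) →
      (∀ (c : F) x, Q x → Q (c • x)) → (∀ x y, Q x → Q y → Q (x * y)) → ∀ x, Q x := by
    intro Q q0 q1 qa qs qm x
    have hx : x ∈ NonUnitalAlgebra.adjoin F {b₀, b₁} := by rw [gen]; trivial
    induction hx using NonUnitalAlgebra.adjoin_induction with
    | mem x hx => rcases hx with rfl | rfl <;> assumption
    | add x y _ _ h h' => exact qa x y h h'
    | zero => simpa using qs 0 _ q0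
    | mul x y _ _ h h' => exact qm x y h h'
    | smul c x _ h => exact qs c x h
  have inT : ∀ x, ι x ∈ T ∧ (ι x).swap ∈ T := by
    refine ind ?_ ?_ ?_ ?_ ?_
    · rw [e0]; exact ⟨t0, t1⟩
    · rw [e1]; exact ⟨t1, t0⟩
    · rintro x y ⟨h, k⟩ ⟨h', k'⟩
      rw [map_add]; exact ⟨add_mem h h', add_mem k k'⟩
    · rintro c x ⟨h, k⟩
      rw [map_smul]; exact ⟨T.smul_mem c h, T.smul_mem c k⟩
    · rintro x y ⟨h, k⟩ ⟨h', k'⟩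
      rw [mul]; exact ⟨tm _ h _ h', tm _ k _ k'⟩
  have sw : ∀ x, ∃ y, ι y = (ι x).swap := by
    refine ind ?_ ?_ ?_ ?_ ?_
    · exact ⟨b₁, by rw [e0, e1]; rfl⟩
    · exact ⟨b₀, by rw [e0, e1]; rfl⟩
    · rintro x y ⟨x', h⟩ ⟨y', h'⟩
      exact ⟨x' + y', by rw [map_add, map_add, h, h']; rfl⟩
    · rintro c x ⟨x', h⟩
      exact ⟨c • x', by rw [map_smul, map_smul, h]; rfl⟩
    · rintro x y ⟨x', h⟩ ⟨y', h'⟩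
      exact ⟨x' * y', by rw [mul, mul, h, h']; rfl⟩
  choose f hf using sw
  have ax0 : IsAxis F α β b₀ := by
    refine axis_pull P inj mul ?_ ?_
    · rw [e0]; exact hV.axis₀.fax.prod hV.axis₁.fax
    · intro x; rw [e0]; exact tp _ (inT x).1
  have ax1 : IsAxis F α β b₁ := by
    refine axis_pull P inj mul ?_ ?_
    · rw [e1]; exact hV.axis₁.fax.prod hV.axis₀.fax
    · intro x; rw [e1]
      obtain ⟨l, v0, h0, v1, h1, v2, h2, e⟩ := tp _ (inT x).2
      have sE : ∀ {μ : F} {v : V × V}, v ∈ eigSp F ((a₀, a₁) : V × V) μ →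
          v.swap ∈ eigSp F ((a₁, a₀) : V × V) μ := fun h => eig_prod.2 (eig_prod.1 h).symm
      refine ⟨l, v0.swap, sE h0, v1.swap, sE h1, v2.swap, sE h2, ?_⟩
      rw [← Prod.swap_swap (ι x), e]; rfl
  let fl : X →ₗ[F] X :=
    { toFun := f
      map_add' := fun x y => inj (by rw [map_add, hf, hf, hf, map_add]; rfl)
      map_smul' := fun c x => inj (by rw [RingHom.id_apply, map_smul, hf, hf, map_smul]; rfl) }
  have finv : Function.Involutive fl := fun x => inj (by
    change ι (f (f x)) = _
    rw [hf, hf, Prod.swap_swap])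
  refine ⟨⟨X⟩, b₀, b₁, ⟨ax0, ax1, gen⟩, ⟨LinearEquiv.ofInvolutive fl finv, ?_, ?_, ?_⟩,
    (LinearMap.fst F V V).comp ι, ?_, ?_, ?_⟩
  · intro x y
    apply inj
    change ι (f (x * y)) = ι (f x * f y)
    rw [hf, mul, mul, hf, hf]; rfl
  · apply inj; change ι (f b₀) = _; rw [hf, e0, e1]; rfl
  · apply inj; change ι (f b₁) = _; rw [hf, e0, e1]; rfl
  · intro v
    have hv : v ∈ NonUnitalAlgebra.adjoin F {a₀, a₁} := by rw [hV.generates]; trivial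
    induction hv using NonUnitalAlgebra.adjoin_induction with
    | mem x hx =>
      rcases hx with rfl | rfl
      · exact ⟨b₀, by simp [e0]⟩
      · exact ⟨b₁, by simp [e1]⟩
    | add x y _ _ h h' =>
      obtain ⟨x, rfl⟩ := h; obtain ⟨y, rfl⟩ := h'
      exact ⟨x + y, map_add _ _ _⟩
    | zero => exact ⟨0, map_zero _⟩
    | mul x y _ _ h h' =>
      obtain ⟨x, rfl⟩ := h; obtain ⟨y, rfl⟩ := h'
      exact ⟨x * y, by simp [mul]⟩
    | smul c x _ h =>
      obtain ⟨x, rfl⟩ := h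
      exact ⟨c • x, map_smul _ _ _⟩
  · intro x y; simp [mul]
  · simp [e0, e1]

instance uliftNN (A : Type v) [NonUnitalNonAssocCommRing A] :
    NonUnitalNonAssocCommRing (ULift.{u} A) :=
  { (inferInstance : NonUnitalNonAssocRing (ULift.{u} A)) with
    mul_comm := fun x y => ULift.ext _ _ (mul_comm _ _) }

theorem quot_of_good {α β : F} (P : Par α β) {a₀ a₁ : V}
    (hV : IsTwoGenerated F α β a₀ a₁) (G : Good α β ((a₀, a₁) : V × V) (a₁, a₀)) :
    IsQuotientOfSymmetric.{u, v} F α β a₀ a₁ := by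
  let W : NonUnitalSubalgebra F (V × V) := NonUnitalAlgebra.adjoin F {(a₀, a₁), (a₁, a₀)}
  have m0 : (a₀, a₁) ∈ W := NonUnitalAlgebra.subset_adjoin F (by simp)
  have m1 : (a₁, a₀) ∈ W := NonUnitalAlgebra.subset_adjoin F (by simp)
  haveI : SMulCommClass F (ULift.{u} W) (ULift.{u} W) :=
    ⟨fun c x y => ULift.ext _ _ (smul_comm c x.down y.down)⟩
  haveI : IsScalarTower F (ULift.{u} W) (ULift.{u} W) :=
    ⟨fun c x y => ULift.ext _ _ (smul_assoc c x.down y.down)⟩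
  let ι : ULift.{u} W →ₗ[F] V × V :=
    { toFun := fun x => x.down.1
      map_add' := fun _ _ => rfl
      map_smul' := fun _ _ => rfl }
  refine quot_of_emb (X := ULift.{u} W) P hV G ι (fun x y h => ULift.ext _ _ (Subtype.ext h))
    (fun _ _ => rfl) ⟨⟨_, m0⟩⟩ ⟨⟨_, m1⟩⟩ rfl rfl ?_
  rw [eq_top_iff]
  rintro ⟨⟨x, hx⟩⟩ -
  induction hx using NonUnitalAlgebra.adjoin_induction with
  | mem x hx =>
    rcases hx with rfl | rfl
    · exact NonUnitalAlgebra.subset_adjoin F (Or.inl rfl)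
    · exact NonUnitalAlgebra.subset_adjoin F (Or.inr rfl)
  | add x y _ _ h h' => exact add_mem h h'
  | zero => exact zero_mem _
  | mul x y _ _ h h' => exact mul_mem h h'
  | smul c x _ h => exact SMulMemClass.smul_mem c h

theorem main_aux {α β : F} (P : Par α β) {a₀ a₁ : V} (hV : IsTwoGenerated F α β a₀ a₁)
    (τ₀ τ₁ : V ≃ₗ[F] V) (hτ₀ : IsMiyamoto F α β a₀ τ₀) (hτ₁ : IsMiyamoto F α β a₁ τ₁)
    (a : ℤ → V) (ha : a = axSeq F a₀ a₁ τ₀ τ₁) (l1 l2 : F)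
    (hl1 : HasProj F α β a₀ a₁ l1) (hl1f : HasProj F α β a₁ a₀ l1)
    (hl2 : HasProj F α β a₀ (a 2) l2) (hl2f : HasProj F α β a₁ (a (-1)) l2)
    (hside : ¬(α = 2 ∧ β = 1 / 2) ∨
      ((∃ l3 : F, HasProj F α β a₀ (a 3) l3 ∧ HasProj F α β a₁ (a (-2)) l3) ∧
        Submodule.span F ({a (-2), a (-1), a 0, a 1, a 2, a 3,
          a 0 * a 1 - β • (a 0 + a 1), a 0 * a 2 - β • (a 0 + a 2)} : Set V) = ⊤)) :
    IsQuotientOfSymmetric.{u, v} F α β a₀ a₁ := by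
  have h0 : a 0 = a₀ := by
    rw [ha]; have := axSeq_even a₀ a₁ τ₀ τ₁ 0; simpa using this
  have h1 : a 1 = a₁ := by
    rw [ha]; have := axSeq_odd a₀ a₁ τ₀ τ₁ 0; simpa using this
  have rf := axSeq_refl (hτ₀.invol hV.axis₀) (hτ₁.invol hV.axis₁) (hτ₀.fixa hV.axis₀)
    (hτ₁.fixa hV.axis₁)
  rw [← ha] at rf
  subst h0 h1
  have D : Dat α β a τ₀ τ₁ :=
    ⟨hV.axis₀, hV.axis₁, hτ₀, hτ₁, fun i => (rf i).1, fun i => (rf i).2⟩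
  exact quot_of_good P hV (D.good P (D.pre hl1 hl1f hl2 hl2f) hside)

end

/-- Proposition reg: if `λ₁ = λ₁^f`, `λ₂ = λ₂^f` and either `(α,β) ≠ (2,1/2)`, or
`λ₃ = λ₃^f` and `V` is spanned by `a₋₂,…,a₃,s₀₁,s₀₂`, then `(V,{a₀,a₁})` is
isomorphic to a quotient of a symmetric algebra. -/
theorem prop_reg {α β : F}
    (hchar : (2 : F) ≠ 0)
    (hα0 : α ≠ 0) (hα1 : α ≠ 1) (hβ0 : β ≠ 0) (hβ1 : β ≠ 1) (hαβ : α ≠ β)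
    {a₀ a₁ : V} (hV : IsTwoGenerated F α β a₀ a₁)
    (τ₀ τ₁ : V ≃ₗ[F] V) (hτ₀ : IsMiyamoto F α β a₀ τ₀) (hτ₁ : IsMiyamoto F α β a₁ τ₁)
    (a : ℤ → V) (ha : a = axSeq F a₀ a₁ τ₀ τ₁)
    (l1 l2 : F)
    (hl1 : HasProj F α β a₀ a₁ l1) (hl1f : HasProj F α β a₁ a₀ l1)
    (hl2 : HasProj F α β a₀ (a 2) l2) (hl2f : HasProj F α β a₁ (a (-1)) l2)
    (hside : ¬(α = 2 ∧ β = 1 / 2) ∨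
      ((∃ l3 : F, HasProj F α β a₀ (a 3) l3 ∧ HasProj F α β a₁ (a (-2)) l3) ∧
        Submodule.span F ({a (-2), a (-1), a 0, a 1, a 2, a 3,
          a 0 * a 1 - β • (a 0 + a 1), a 0 * a 2 - β • (a 0 + a 2)} : Set V) = ⊤)) :
    IsQuotientOfSymmetric F α β a₀ a₁ := by
  exact main_aux ⟨hchar, hα0, hα1, hβ0, hβ1, hαβ⟩ hV τ₀ τ₁ hτ₀ hτ₁ a ha l1 l2 hl1 hl1f hl2 hl2f hside

end AxialFormal
end
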